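/- Under the standing assumptions, for every n ≥ 1 and every 0 ≤ i ≤ n−1, the map Φ intertwines the i-th face of the cyclic module of A#_σH with the diagonal face d_i∘δ_i: (d_i∘δ_i)∘Φ = Φ∘δ_i^{A#_σH} as maps (A#_σH)^{⊗(n+1)} → H^{⊗n}⊗A^{⊗n}, where δ_i^{A#_σH}(x_0⊗⋯⊗x_n) = x_0⊗⋯⊗x_ix_{i+1}⊗⋯⊗x_n, δ_i(g_0,…,g_n | a_0,…,a_n) = (g_0,…,g_n | a_0,…,a_ia_{i+1},…,a_n), and d_i(g_0,…,g_n | a_0,…,a_{n−1}) = (g_0,…,g_i⁽¹⁾g_{i+1}⁽¹⁾,…,g_n | σ(g_i⁽²⁾,g_{i+1}⁽²⁾)a_0, a_1,…,a_{n−1}). -/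

import Mathlib

open TensorProduct

noncomputable section

/-! ## Tensor powers, iterated comultiplication and Sweedler representations -/

/-- `Tpow k V n` is the `(n+1)`-fold tensor power `V ⊗ V ⊗ ⋯ ⊗ V` (`n+1` factors),
bundled as an object of `ModuleCat k`. -/
def Tpow (k : Type) [Field k] (V : Type) [AddCommGroup V] [Module k V] : ℕ → ModuleCat k
  | 0 => ModuleCat.of k V
  | n + 1 => ModuleCat.of k (V ⊗[k] (Tpow k V n))

/-- The elementary tensor `f 0 ⊗ f 1 ⊗ ⋯ ⊗ f n` in `Tpow k V n`. -/
def tpow (k : Type) [Field k] (V : Type) [AddCommGroup V] [Module k V] :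
    (n : ℕ) → (Fin (n + 1) → V) → Tpow k V n
  | 0, f => (f 0 : V)
  | n + 1, f => (f 0 ⊗ₜ[k] tpow k V n (fun i => f i.succ) : V ⊗[k] Tpow k V n)

/-- The iterated comultiplication `Δ⁽ⁿ⁾ : H → H^{⊗(n+1)}`, `Δ⁽⁰⁾ = id`,
`Δ⁽ⁿ⁺¹⁾ = (1 ⊗ Δ⁽ⁿ⁾) ∘ Δ`. -/
def comulIter (k : Type) [Field k] (H : Type) [Ring H] [HopfAlgebra k H] :
    (n : ℕ) → H →ₗ[k] Tpow k H n
  | 0 => LinearMap.id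
  | n + 1 =>
    (LinearMap.lTensor H (comulIter k H n) ∘ₗ Coalgebra.comul :
      H →ₗ[k] (H ⊗[k] Tpow k H n))

/-- A finite Sweedler-type representation `Δ⁽ⁿ⁾ h = ∑ᵢ h⁽¹⁾ᵢ ⊗ ⋯ ⊗ h⁽ⁿ⁺¹⁾ᵢ` of the iterated
comultiplication of `h`; `leg i j` is the `(j+1)`-st Sweedler leg of the `i`-th summand. -/
structure IterRepr (k : Type) [Field k] (H : Type) [Ring H] [HopfAlgebra k H]
    (n : ℕ) (h : H) where
  ι : Type
  s : Finset ι
  leg : ι → Fin (n + 1) → H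
  eq : ∑ i ∈ s, tpow k H n (leg i) = comulIter k H n h

/-- Merge an `(n+1)`-tuple to an `n`-tuple, replacing the two entries at positions `i, i+1`
by the single entry `v`. -/
def mergeAt {V : Type} {n : ℕ} (i : Fin n) (x : Fin (n + 1) → V) (v : V) :
    Fin n → V :=
  fun j => if (j : ℕ) < (i : ℕ) then x (Fin.castSucc j) else
    if (j : ℕ) = (i : ℕ) then v else x j.succ

variable (k : Type) [Field k] (H : Type) [Ring H] [HopfAlgebra k H]

/-- `H` is cocommutative. -/
def Cocomm : Prop :=
  ∀ h : H, (TensorProduct.comm k H H) (Coalgebra.comul (R := k) h) = Coalgebra.comul (R := k) h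

variable (A : Type) [Ring A] [Algebra k A]
variable (rho : H →ₗ[k] A →ₗ[k] A)

/-- `rho` is a weak action of `H` on `A`:
`h(ab) = h⁽¹⁾(a)h⁽²⁾(b)`, `h(1) = ε(h)1` and `1(a) = a`. -/
def IsWeakAction : Prop :=
  (∀ (h : H) (a b : A) (R : IterRepr k H 1 h),
      rho h (a * b) = ∑ i ∈ R.s, rho (R.leg i 0) a * rho (R.leg i 1) b) ∧
  (∀ h : H, rho h (1 : A) = Coalgebra.counit (R := k) h • (1 : A)) ∧
  (∀ a : A, rho 1 a = a)

/-- `rho` makes `A` a left `H`-module algebra: a weak action which is an action. -/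
def IsModuleAlgebraAction : Prop :=
  IsWeakAction k H A rho ∧ (∀ (h l : H) (a : A), rho (h * l) a = rho h (rho l a))

variable (sg : H →ₗ[k] H →ₗ[k] k)

/-- Normality for a `k`-valued cocycle: `σ(h,1) = σ(1,h) = ε(h)`. -/
def NormalK : Prop :=
  ∀ h : H, sg h 1 = Coalgebra.counit (R := k) h ∧ sg 1 h = Coalgebra.counit (R := k) h

/-- The cocycle property for a `k`-valued cocycle:
`σ(l⁽¹⁾,m⁽¹⁾)σ(h,l⁽²⁾m⁽²⁾) = σ(h⁽¹⁾,l⁽¹⁾)σ(h⁽²⁾l⁽²⁾,m)`. -/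
def CocycleK : Prop :=
  ∀ (h l m : H) (Rh : IterRepr k H 1 h) (Rl : IterRepr k H 1 l) (Rm : IterRepr k H 1 m),
    ∑ j ∈ Rl.s, ∑ c ∈ Rm.s,
        sg (Rl.leg j 0) (Rm.leg c 0) * sg h (Rl.leg j 1 * Rm.leg c 1) =
      ∑ i ∈ Rh.s, ∑ j ∈ Rl.s,
        sg (Rh.leg i 0) (Rl.leg j 0) * sg (Rh.leg i 1 * Rl.leg j 1) m

/-- The twisted module property for a `k`-valued cocycle:
`h⁽¹⁾(l⁽¹⁾(a))σ(h⁽²⁾,l⁽²⁾) = σ(h⁽¹⁾,l⁽¹⁾)(h⁽²⁾l⁽²⁾)(a)`. -/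
def TwistedModuleK : Prop :=
  ∀ (h l : H) (a : A) (Rh : IterRepr k H 1 h) (Rl : IterRepr k H 1 l),
    ∑ i ∈ Rh.s, ∑ j ∈ Rl.s,
        sg (Rh.leg i 1) (Rl.leg j 1) • rho (Rh.leg i 0) (rho (Rl.leg j 0) a) =
      ∑ i ∈ Rh.s, ∑ j ∈ Rl.s,
        sg (Rh.leg i 0) (Rl.leg j 0) • rho (Rh.leg i 1 * Rl.leg j 1) a

/-- The `k`-valued map `σ`, viewed in the convolution algebra `Hom_k(H ⊗ H, A)` via
`x ⊗ y ↦ σ(x,y)1_A`, is convolution invertible. -/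
def ConvInvertibleK : Prop :=
  ∃ sg' : H →ₗ[k] H →ₗ[k] A,
    ∀ (h l : H) (Rh : IterRepr k H 1 h) (Rl : IterRepr k H 1 l),
      (∑ i ∈ Rh.s, ∑ j ∈ Rl.s,
          (sg (Rh.leg i 0) (Rl.leg j 0) • (1 : A)) * sg' (Rh.leg i 1) (Rl.leg j 1) =
        (Coalgebra.counit (R := k) h * Coalgebra.counit (R := k) l) • (1 : A)) ∧
      (∑ i ∈ Rh.s, ∑ j ∈ Rl.s,
          sg' (Rh.leg i 0) (Rl.leg j 0) * (sg (Rh.leg i 1) (Rl.leg j 1) • (1 : A)) =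
        (Coalgebra.counit (R := k) h * Coalgebra.counit (R := k) l) • (1 : A))

/-- Normality, as an identity in `A`: `σ(h,1) = σ(1,h) = ε(h)1_A`. -/
def NormalKA : Prop :=
  ∀ h : H, sg h 1 • (1 : A) = Coalgebra.counit (R := k) h • (1 : A) ∧
    sg 1 h • (1 : A) = Coalgebra.counit (R := k) h • (1 : A)

/-- The cocycle property, as an identity in `A` (values of `σ` lie in `k·1_A`):
`σ(l⁽¹⁾,m⁽¹⁾)σ(h,l⁽²⁾m⁽²⁾) = σ(h⁽¹⁾,l⁽¹⁾)σ(h⁽²⁾l⁽²⁾,m)`. -/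
def CocycleKA : Prop :=
  ∀ (h l m : H) (Rh : IterRepr k H 1 h) (Rl : IterRepr k H 1 l) (Rm : IterRepr k H 1 m),
    ∑ j ∈ Rl.s, ∑ c ∈ Rm.s,
        (sg (Rl.leg j 0) (Rm.leg c 0) * sg h (Rl.leg j 1 * Rm.leg c 1)) • (1 : A) =
      ∑ i ∈ Rh.s, ∑ j ∈ Rl.s,
        (sg (Rh.leg i 0) (Rl.leg j 0) * sg (Rh.leg i 1 * Rl.leg j 1) m) • (1 : A)

/-! ## The operators of the cylindrical module `A ♮_σ H` -/

/-- Spec of the horizontal face `dᵢ` (`0 ≤ i < P`) on `H^{⊗(P+1)} ⊗ A^{⊗(q+1)}`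
(here `P = p+1`):
`dᵢ(g₀,…,g_P | a₀,…,a_q) = (g₀,…,gᵢ⁽¹⁾g_{i+1}⁽¹⁾,…,g_P | σ(gᵢ⁽²⁾,g_{i+1}⁽²⁾)a₀, a₁,…,a_q)`. -/
def IsHorFace (p q : ℕ) (i : Fin (p + 1))
    (D : ((Tpow k H (p + 1) : Type) ⊗[k] (Tpow k A q : Type)) →ₗ[k]
      ((Tpow k H p : Type) ⊗[k] (Tpow k A q : Type))) : Prop :=
  ∀ (g : Fin (p + 2) → H) (a : Fin (q + 1) → A)
    (R : IterRepr k H 1 (g i.castSucc)) (S : IterRepr k H 1 (g i.succ)),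
    D (tpow k H (p + 1) g ⊗ₜ[k] tpow k A q a) =
      ∑ r ∈ R.s, ∑ s ∈ S.s,
        tpow k H p (mergeAt i g (R.leg r 0 * S.leg s 0)) ⊗ₜ[k]
          tpow k A q (Function.update a 0 (sg (R.leg r 1) (S.leg s 1) • a 0))

/-- Spec of the last horizontal face `d_P` on `H^{⊗(P+1)} ⊗ A^{⊗(q+1)}` (here `P = p+1`):
`d_P(g₀,…,g_P | a₀,…,a_q) = (g_P^{(q+2)}g₀⁽¹⁾, g₁,…,g_{P−1} |
σ(g_P^{(q+3)},g₀⁽²⁾)g_P⁽¹⁾(a₀), g_P⁽²⁾(a₁),…,g_P^{(q+1)}(a_q))`. -/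
def IsLastHorFace (p q : ℕ)
    (D : ((Tpow k H (p + 1) : Type) ⊗[k] (Tpow k A q : Type)) →ₗ[k]
      ((Tpow k H p : Type) ⊗[k] (Tpow k A q : Type))) : Prop :=
  ∀ (g : Fin (p + 2) → H) (a : Fin (q + 1) → A)
    (R : IterRepr k H (q + 2) (g (Fin.last (p + 1)))) (S : IterRepr k H 1 (g 0)),
    D (tpow k H (p + 1) g ⊗ₜ[k] tpow k A q a) =
      ∑ r ∈ R.s, ∑ s ∈ S.s,
        tpow k H p
          (Fin.cases (R.leg r ⟨q + 1, by omega⟩ * S.leg s 0)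
            (fun j : Fin p => g j.succ.castSucc)) ⊗ₜ[k]
        tpow k A q (fun c : Fin (q + 1) =>
          if c = 0 then
            sg (R.leg r ⟨q + 2, by omega⟩) (S.leg s 1) • rho (R.leg r 0) (a 0)
          else rho (R.leg r (Fin.castLE (by omega) c)) (a c))

/-- Spec of the horizontal cyclic operator `t` on `H^{⊗(p+1)} ⊗ A^{⊗(q+1)}`:
`t(g₀,…,g_p | a₀,…,a_q) = (g_p^{(q+2)}, g₀,…,g_{p−1} | g_p⁽¹⁾(a₀),…,g_p^{(q+1)}(a_q))`. -/
def IsCycT (p q : ℕ)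
    (T : ((Tpow k H p : Type) ⊗[k] (Tpow k A q : Type)) →ₗ[k]
      ((Tpow k H p : Type) ⊗[k] (Tpow k A q : Type))) : Prop :=
  ∀ (g : Fin (p + 1) → H) (a : Fin (q + 1) → A)
    (R : IterRepr k H (q + 1) (g (Fin.last p))),
    T (tpow k H p g ⊗ₜ[k] tpow k A q a) =
      ∑ r ∈ R.s,
        tpow k H p (Fin.cases (R.leg r (Fin.last (q + 1))) (fun j : Fin p => g j.castSucc))
          ⊗ₜ[k]
        tpow k A q (fun c : Fin (q + 1) => rho (R.leg r c.castSucc) (a c))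

/-- Spec of the vertical cyclic operator `τ` on `H^{⊗(p+1)} ⊗ A^{⊗(q+1)}`:
`τ(g₀,…,g_p | a₀,…,a_q) = (g₀⁽²⁾,…,g_p⁽²⁾ | S(g₀⁽¹⁾⋯g_p⁽¹⁾)(a_q), a₀,…,a_{q−1})`. -/
def IsCycTau (p q : ℕ)
    (T : ((Tpow k H p : Type) ⊗[k] (Tpow k A q : Type)) →ₗ[k]
      ((Tpow k H p : Type) ⊗[k] (Tpow k A q : Type))) : Prop :=
  ∀ (g : Fin (p + 1) → H) (a : Fin (q + 1) → A)
    (R : ∀ i : Fin (p + 1), IterRepr k H 1 (g i)),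
    T (tpow k H p g ⊗ₜ[k] tpow k A q a) =
      ∑ e ∈ Fintype.piFinset (fun i => (R i).s),
        tpow k H p (fun i => (R i).leg (e i) 1) ⊗ₜ[k]
        tpow k A q
          (Fin.cases
            (rho (HopfAlgebra.antipode (R := k)
                ((List.ofFn (fun i : Fin (p + 1) => (R i).leg (e i) 0)).prod))
              (a (Fin.last q)))
            (fun c : Fin q => a c.castSucc))

/-- Spec of the vertical face `δᵢ` (`0 ≤ i < Q`) on `H^{⊗(p+1)} ⊗ A^{⊗(Q+1)}`
(here `Q = q+1`): `δᵢ(g | a₀,…,a_Q) = (g | a₀,…,aᵢa_{i+1},…,a_Q)`. -/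
def IsVerFace (p q : ℕ) (i : Fin (q + 1))
    (D : ((Tpow k H p : Type) ⊗[k] (Tpow k A (q + 1) : Type)) →ₗ[k]
      ((Tpow k H p : Type) ⊗[k] (Tpow k A q : Type))) : Prop :=
  ∀ (g : Fin (p + 1) → H) (a : Fin (q + 2) → A),
    D (tpow k H p g ⊗ₜ[k] tpow k A (q + 1) a) =
      tpow k H p g ⊗ₜ[k] tpow k A q (mergeAt i a (a i.castSucc * a i.succ))

/-- Spec of the last vertical face `δ_Q` on `H^{⊗(p+1)} ⊗ A^{⊗(Q+1)}` (here `Q = q+1`):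
`δ_Q(g₀,…,g_p | a₀,…,a_Q) = (g₀⁽²⁾,…,g_p⁽²⁾ | S(g₀⁽¹⁾⋯g_p⁽¹⁾)(a_Q)a₀, a₁,…,a_{Q−1})`. -/
def IsLastVerFace (p q : ℕ)
    (D : ((Tpow k H p : Type) ⊗[k] (Tpow k A (q + 1) : Type)) →ₗ[k]
      ((Tpow k H p : Type) ⊗[k] (Tpow k A q : Type))) : Prop :=
  ∀ (g : Fin (p + 1) → H) (a : Fin (q + 2) → A)
    (R : ∀ i : Fin (p + 1), IterRepr k H 1 (g i)),
    D (tpow k H p g ⊗ₜ[k] tpow k A (q + 1) a) =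
      ∑ e ∈ Fintype.piFinset (fun i => (R i).s),
        tpow k H p (fun i => (R i).leg (e i) 1) ⊗ₜ[k]
        tpow k A q
          (Fin.cases
            (rho (HopfAlgebra.antipode (R := k)
                ((List.ofFn (fun i : Fin (p + 1) => (R i).leg (e i) 0)).prod))
              (a (Fin.last (q + 1))) * a 0)
            (fun c : Fin q => a c.succ.castSucc))

/-! ## The crossed product `A #_σ H`, its cyclic module, and the maps `Φ`, `Ψ` -/

/-- Spec of the multiplication of the crossed product `A #_σ H` on `A ⊗ H`:
`(a ⊗ h)(b ⊗ l) = a h⁽¹⁾(b) σ(h⁽²⁾,l⁽¹⁾) ⊗ h⁽³⁾l⁽²⁾`. -/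
def IsCrossedMul (mul : (A ⊗[k] H) →ₗ[k] (A ⊗[k] H) →ₗ[k] (A ⊗[k] H)) : Prop :=
  ∀ (a b : A) (h l : H) (R : IterRepr k H 2 h) (S : IterRepr k H 1 l),
    mul (a ⊗ₜ[k] h) (b ⊗ₜ[k] l) =
      ∑ i ∈ R.s, ∑ j ∈ S.s,
        (sg (R.leg i 1) (S.leg j 0) • (a * rho (R.leg i 0) b)) ⊗ₜ[k]
          (R.leg i 2 * S.leg j 1)

/-- Spec of the map `Φ : (A #_σ H)^{⊗(n+1)} → H^{⊗(n+1)} ⊗ A^{⊗(n+1)}`: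
`Φ(a₀ ⊗ g₀,…,aₙ ⊗ gₙ) = (g₀⁽²⁾, g₁⁽³⁾,…,gₙ⁽ⁿ⁺²⁾ | S(g₀⁽¹⁾g₁⁽²⁾⋯gₙ⁽ⁿ⁺¹⁾)(a₀),…,S(gₙ⁽¹⁾)(aₙ))`. -/
def IsPhi (n : ℕ)
    (Phi : (Tpow k (A ⊗[k] H) n : Type) →ₗ[k]
      ((Tpow k H n : Type) ⊗[k] (Tpow k A n : Type))) : Prop :=
  ∀ (a : Fin (n + 1) → A) (g : Fin (n + 1) → H)
    (R : ∀ i : Fin (n + 1), IterRepr k H ((i : ℕ) + 1) (g i)),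
    Phi (tpow k (A ⊗[k] H) n (fun i => a i ⊗ₜ[k] g i)) =
      ∑ e ∈ Fintype.piFinset (fun i => (R i).s),
        tpow k H n (fun i => (R i).leg (e i) (Fin.last ((i : ℕ) + 1))) ⊗ₜ[k]
        tpow k A n (fun i =>
          rho (HopfAlgebra.antipode (R := k)
              ((List.ofFn (fun m : Fin (n + 1 - (i : ℕ)) =>
                (R ⟨(i : ℕ) + (m : ℕ), by have := m.isLt; have := i.isLt; omega⟩).leg
                  (e ⟨(i : ℕ) + (m : ℕ), by have := m.isLt; have := i.isLt; omega⟩)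
                  ⟨(m : ℕ), by have := m.isLt; have := i.isLt; simp; omega⟩)).prod))
            (a i))

/-- Spec of the map `Ψ : H^{⊗(n+1)} ⊗ A^{⊗(n+1)} → (A #_σ H)^{⊗(n+1)}`:
`Ψ(g₀,…,gₙ | a₀,…,aₙ) = ((g₀⁽¹⁾⋯gₙ⁽¹⁾)(a₀) ⊗ g₀⁽²⁾,…, gₙ⁽ⁿ⁺¹⁾(aₙ) ⊗ gₙ⁽ⁿ⁺²⁾)`. -/
def IsPsi (n : ℕ)
    (Psi : ((Tpow k H n : Type) ⊗[k] (Tpow k A n : Type)) →ₗ[k]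
      (Tpow k (A ⊗[k] H) n : Type)) : Prop :=
  ∀ (g : Fin (n + 1) → H) (a : Fin (n + 1) → A)
    (R : ∀ i : Fin (n + 1), IterRepr k H ((i : ℕ) + 1) (g i)),
    Psi (tpow k H n g ⊗ₜ[k] tpow k A n a) =
      ∑ e ∈ Fintype.piFinset (fun i => (R i).s),
        tpow k (A ⊗[k] H) n (fun i =>
          (rho ((List.ofFn (fun m : Fin (n + 1 - (i : ℕ)) =>
                (R ⟨(i : ℕ) + (m : ℕ), by have := m.isLt; have := i.isLt; omega⟩).leg
                  (e ⟨(i : ℕ) + (m : ℕ), by have := m.isLt; have := i.isLt; omega⟩)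
                  ⟨(i : ℕ), by have := m.isLt; have := i.isLt; simp; omega⟩)).prod)
            (a i)) ⊗ₜ[k]
          (R i).leg (e i) (Fin.last ((i : ℕ) + 1)))

/-- Spec of the cyclic operator of the cyclic module of an algebra, on `X^{⊗(n+1)}`:
`τ(x₀ ⊗ ⋯ ⊗ xₙ) = xₙ ⊗ x₀ ⊗ ⋯ ⊗ x_{n−1}`. -/
def IsAlgCyc (X : Type) [AddCommGroup X] [Module k X] (n : ℕ)
    (C : (Tpow k X n : Type) →ₗ[k] (Tpow k X n : Type)) : Prop :=
  ∀ x : Fin (n + 1) → X,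
    C (tpow k X n x) =
      tpow k X n (Fin.cases (x (Fin.last n)) (fun j : Fin n => x j.castSucc))

/-- Spec of the face `δᵢ` (`0 ≤ i < n+1`) of the cyclic module of the algebra
`(A ⊗ H, mul)`: `δᵢ(x₀ ⊗ ⋯ ⊗ x_{n+1}) = x₀ ⊗ ⋯ ⊗ xᵢx_{i+1} ⊗ ⋯ ⊗ x_{n+1}`. -/
def IsAlgFace (mul : (A ⊗[k] H) →ₗ[k] (A ⊗[k] H) →ₗ[k] (A ⊗[k] H)) (n : ℕ) (i : Fin (n + 1))
    (D : (Tpow k (A ⊗[k] H) (n + 1) : Type) →ₗ[k] (Tpow k (A ⊗[k] H) n : Type)) : Prop :=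
  ∀ x : Fin (n + 2) → A ⊗[k] H,
    D (tpow k (A ⊗[k] H) (n + 1) x) =
      tpow k (A ⊗[k] H) n (mergeAt i x (mul (x i.castSucc) (x i.succ)))

/-- Spec of the last face `δ_{n+1}` of the cyclic module of the algebra `(A ⊗ H, mul)`:
`δ_{n+1}(x₀ ⊗ ⋯ ⊗ x_{n+1}) = x_{n+1}x₀ ⊗ x₁ ⊗ ⋯ ⊗ xₙ`. -/
def IsAlgLastFace (mul : (A ⊗[k] H) →ₗ[k] (A ⊗[k] H) →ₗ[k] (A ⊗[k] H)) (n : ℕ)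
    (D : (Tpow k (A ⊗[k] H) (n + 1) : Type) →ₗ[k] (Tpow k (A ⊗[k] H) n : Type)) : Prop :=
  ∀ x : Fin (n + 2) → A ⊗[k] H,
    D (tpow k (A ⊗[k] H) (n + 1) x) =
      tpow k (A ⊗[k] H) n
        (Fin.cases (mul (x (Fin.last (n + 1))) (x 0)) (fun j : Fin n => x j.succ.castSucc))

attribute [fun_prop] IsLinearMap

section LinearPredicates

variable {k M N P V : Type*} [Field k] [AddCommMonoid M] [Module k M] [AddCommMonoid N] [Module k N]
  [AddCommMonoid P] [Module k P] [AddCommMonoid V] [Module k V]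

@[fun_prop]
theorem isLinearMap_id' : IsLinearMap k fun x : M => x := ⟨fun _ _ => rfl, fun _ _ => rfl⟩

@[fun_prop]
theorem isLinearMap_comp {f : N → P} {g : M → N} (hf : IsLinearMap k f) (hg : IsLinearMap k g) :
    IsLinearMap k fun x : M => f (g x) :=
  ⟨fun x y => by rw [hg.map_add, hf.map_add], fun x y => by rw [hg.map_smul, hf.map_smul]⟩

@[fun_prop]
theorem isLinearMap_coe (L : N →ₗ[k] P) : IsLinearMap k fun x : N => L x :=
  ⟨L.map_add, L.map_smul⟩

@[fun_prop]
theorem isLinearMap_coe_comp {f : M → N} (L : N →ₗ[k] P) (hf : IsLinearMap k f) :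
    IsLinearMap k fun x : M => L (f x) :=
  isLinearMap_comp (isLinearMap_coe L) hf

@[fun_prop]
theorem isLinearMap_coe_apply {f : M → N} (L : N →ₗ[k] P →ₗ[k] V) (hf : IsLinearMap k f) (c : P) :
    IsLinearMap k fun x : M => L (f x) c :=
  isLinearMap_comp (isLinearMap_coe (L.flip c)) hf

@[fun_prop]
theorem isLinearMap_mul_const {A : Type*} [Ring A] [Algebra k A] {f : M → A}
    (hf : IsLinearMap k f) (c : A) : IsLinearMap k fun x : M => f x * c :=
  ⟨fun x y => by rw [hf.map_add, add_mul], fun x y => by rw [hf.map_smul, smul_mul_assoc]⟩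

@[fun_prop]
theorem isLinearMap_const_mul {A : Type*} [Ring A] [Algebra k A] {f : M → A}
    (hf : IsLinearMap k f) (c : A) : IsLinearMap k fun x : M => c * f x :=
  ⟨fun x y => by rw [hf.map_add, mul_add], fun x y => by rw [hf.map_smul, mul_smul_comm]⟩

@[fun_prop]
theorem isLinearMap_tmul_const {f : M → N} (hf : IsLinearMap k f) (c : P) :
    IsLinearMap k fun x : M => f x ⊗ₜ[k] c :=
  ⟨fun x y => by rw [hf.map_add, TensorProduct.add_tmul], fun x y => by rw [hf.map_smul]; rfl⟩

@[fun_prop]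
theorem isLinearMap_const_tmul {f : M → N} (hf : IsLinearMap k f) (c : P) :
    IsLinearMap k fun x : M => c ⊗ₜ[k] f x :=
  ⟨fun x y => by rw [hf.map_add, TensorProduct.tmul_add],
    fun x y => by rw [hf.map_smul, TensorProduct.tmul_smul]⟩

@[fun_prop]
theorem isLinearMap_smul_const {f : M → k} (hf : IsLinearMap k f) (c : P) :
    IsLinearMap k fun x : M => f x • c :=
  ⟨fun x y => by rw [hf.map_add, add_smul], fun x y => by rw [hf.map_smul, smul_assoc]⟩

@[fun_prop]
theorem isLinearMap_const_smul {f : M → N} (hf : IsLinearMap k f) (c : k) :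
    IsLinearMap k fun x : M => c • f x :=
  ⟨fun x y => by rw [hf.map_add, smul_add], fun x y => by rw [hf.map_smul, smul_comm]⟩

/-- The linear map with underlying bilinear function `f`. -/
def mkBilinear (f : M → N → V) (h₁ : ∀ y, IsLinearMap k fun x => f x y)
    (h₂ : ∀ x, IsLinearMap k fun y => f x y) : M →ₗ[k] N →ₗ[k] V :=
  LinearMap.mk₂ k f (fun x x' y => (h₁ y).map_add x x') (fun c x y => (h₁ y).map_smul c x)
    (fun x y y' => (h₂ x).map_add y y') (fun c x y => (h₂ x).map_smul c y)

@[simp]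
theorem mkBilinear_apply (f : M → N → V) (h₁ : ∀ y, IsLinearMap k fun x => f x y)
    (h₂ : ∀ x, IsLinearMap k fun y => f x y) (x : M) (y : N) : mkBilinear f h₁ h₂ x y = f x y :=
  rfl

theorem tensor_eq_of_isLinearMap {f g : M ⊗[k] N → V} (hf : IsLinearMap k f) (hg : IsLinearMap k g)
    (h : ∀ x y, f (x ⊗ₜ[k] y) = g (x ⊗ₜ[k] y)) (t : M ⊗[k] N) : f t = g t := by
  induction t using TensorProduct.induction_on with
  | zero => rw [hf.map_zero, hg.map_zero]
  | tmul x y => exact h x y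
  | add x y hx hy => rw [hf.map_add, hg.map_add, hx, hy]

end LinearPredicates

section Sweedler

variable {k M N P Q V W : Type*} [Field k] [AddCommMonoid M] [Module k M]
  [AddCommMonoid N] [Module k N] [AddCommMonoid P] [Module k P] [AddCommMonoid Q] [Module k Q]
  [AddCommMonoid V] [Module k V] [AddCommMonoid W] [Module k W]

/-- The sum `∑ F x y` over a chosen decomposition `t = ∑ x ⊗ y`. -/
def sweedler {X : Type*} [AddCommMonoid X] (t : M ⊗[k] N) (F : M → N → X) : X :=
  ∑ p ∈ (TensorProduct.exists_finset t).choose, F p.1 p.2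

theorem sweedler_tmul_self (t : M ⊗[k] N) : sweedler t (fun x y => x ⊗ₜ[k] y) = t :=
  (TensorProduct.exists_finset t).choose_spec.symm

theorem map_sweedler {f : V → W} (hf : IsLinearMap k f) (t : M ⊗[k] N) (F : M → N → V) :
    f (sweedler t F) = sweedler t fun x y => f (F x y) :=
  map_sum (IsLinearMap.mk' f hf) _ _

theorem sweedler_comm {X : Type*} [AddCommMonoid X] (t : M ⊗[k] N) (s : P ⊗[k] Q)
    (F : M → N → P → Q → X) :
    sweedler t (fun x y => sweedler s (F x y)) =
      sweedler s fun z w => sweedler t fun x y => F x y z w :=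
  Finset.sum_comm

theorem sweedler_eq_lift (t : M ⊗[k] N) (F : M → N → V) (h₁ : ∀ y, IsLinearMap k fun x => F x y)
    (h₂ : ∀ x, IsLinearMap k fun y => F x y) :
    sweedler t F = TensorProduct.lift (mkBilinear F h₁ h₂) t := by
  conv_rhs => rw [← sweedler_tmul_self t]
  simp [sweedler]

@[fun_prop]
theorem isLinearMap_sweedler {f : P → M ⊗[k] N} (hf : IsLinearMap k f) (F : M → N → V)
    (h₁ : ∀ y, IsLinearMap k fun x => F x y) (h₂ : ∀ x, IsLinearMap k fun y => F x y) :
    IsLinearMap k fun z => sweedler (f z) F := by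
  simp only [sweedler_eq_lift _ F h₁ h₂]
  fun_prop

@[fun_prop]
theorem isLinearMap_sweedler_fun (t : M ⊗[k] N) (F : P → M → N → V)
    (h : ∀ x y, IsLinearMap k fun z => F z x y) : IsLinearMap k fun z => sweedler t (F z) :=
  ⟨fun a b => by simp only [sweedler, (h _ _).map_add, Finset.sum_add_distrib],
    fun c a => by simp only [sweedler, (h _ _).map_smul, Finset.smul_sum]⟩

theorem sweedler_tmul (x : M) (y : N) (F : M → N → V) (h₁ : ∀ y, IsLinearMap k fun x => F x y)
    (h₂ : ∀ x, IsLinearMap k fun y => F x y) : sweedler (x ⊗ₜ[k] y) F = F x y := by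
  simp [sweedler_eq_lift _ F h₁ h₂]

theorem sweedler_sum {ι : Type*} (s : Finset ι) (t : ι → M ⊗[k] N) (F : M → N → V)
    (h₁ : ∀ y, IsLinearMap k fun x => F x y) (h₂ : ∀ x, IsLinearMap k fun y => F x y) :
    sweedler (∑ i ∈ s, t i) F = ∑ i ∈ s, sweedler (t i) F := by
  simp only [sweedler_eq_lift _ F h₁ h₂, map_sum]

theorem sweedler_sweedler (t : P ⊗[k] Q) (g : P → Q → M ⊗[k] N) (F : M → N → V)
    (h₁ : ∀ y, IsLinearMap k fun x => F x y) (h₂ : ∀ x, IsLinearMap k fun y => F x y) :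
    sweedler (sweedler t g) F = sweedler t fun x y => sweedler (g x y) F :=
  map_sweedler (f := fun u => sweedler u F) (by fun_prop) t g

end Sweedler

section Hopf

variable {k H A N V W : Type*} [Field k] [Ring H] [HopfAlgebra k H] [Ring A] [Algebra k A]
  [AddCommMonoid N] [Module k N] [AddCommMonoid V] [Module k V] [AddCommMonoid W] [Module k W]

local notation "Δ" => Coalgebra.comul (R := k)
local notation "S" => HopfAlgebra.antipode k

/-- Coassociativity of a left coaction. -/
def IsCoassoc (c : N →ₗ[k] H ⊗[k] N) : Prop :=
  ∀ n, TensorProduct.assoc k H H N (LinearMap.rTensor N Coalgebra.comul (c n)) =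
    LinearMap.lTensor H c (c n)

theorem isCoassoc_comul : IsCoassoc (Coalgebra.comul : H →ₗ[k] H ⊗[k] H) :=
  Coalgebra.coassoc_apply

theorem IsCoassoc.sweedler_eq {c : N →ₗ[k] H ⊗[k] N} (hc : IsCoassoc c) (n : N)
    (F : H → H → N → V) (h₁ : ∀ y z, IsLinearMap k fun x => F x y z)
    (h₂ : ∀ x z, IsLinearMap k fun y => F x y z) (h₃ : ∀ x y, IsLinearMap k fun z => F x y z) :
    sweedler (c n) (fun x m => sweedler (Δ x) fun x₁ x₂ => F x₁ x₂ m) =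
      sweedler (c n) fun x m => sweedler (c m) fun y m' => F x y m' := by
  have hL : ∀ t, sweedler (LinearMap.lTensor H c t) (fun x s => sweedler s (F x)) =
      sweedler t fun x m => sweedler (c m) fun y m' => F x y m' := by
    refine tensor_eq_of_isLinearMap (by fun_prop) (by fun_prop) fun x m => ?_
    rw [LinearMap.lTensor_tmul, sweedler_tmul _ _ _ (by fun_prop) (by fun_prop),
      sweedler_tmul _ _ _ (by fun_prop) (by fun_prop)]
  have hR : ∀ t, sweedler (TensorProduct.assoc k H H N (LinearMap.rTensor N Coalgebra.comul t))
      (fun x s => sweedler s (F x)) =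
      sweedler t fun x m => sweedler (Δ x) fun x₁ x₂ => F x₁ x₂ m := by
    refine tensor_eq_of_isLinearMap (isLinearMap_sweedler (isLinearMap_comp
      (isLinearMap_coe (TensorProduct.assoc k H H N).toLinearMap) (by fun_prop)) _
      (by fun_prop) (by fun_prop)) (by fun_prop) fun x m => ?_
    rw [LinearMap.rTensor_tmul, sweedler_tmul _ _ _ (by fun_prop) (by fun_prop)]
    generalize Δ x = u
    revert u
    refine tensor_eq_of_isLinearMap (isLinearMap_sweedler (isLinearMap_comp
      (isLinearMap_coe (TensorProduct.assoc k H H N).toLinearMap) (by fun_prop)) _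
      (by fun_prop) (by fun_prop)) (by fun_prop) fun x y => ?_
    rw [TensorProduct.assoc_tmul, sweedler_tmul _ _ _ (by fun_prop) (by fun_prop),
      sweedler_tmul _ _ _ (by fun_prop) (by fun_prop),
      sweedler_tmul _ _ _ (by fun_prop) (by fun_prop)]
  rw [← hL, ← hR, hc n]

theorem sweedler_coassoc (h : H) (F : H → H → H → V) (h₁ : ∀ y z, IsLinearMap k fun x => F x y z)
    (h₂ : ∀ x z, IsLinearMap k fun y => F x y z) (h₃ : ∀ x y, IsLinearMap k fun z => F x y z) :
    sweedler (Δ h) (fun x z => sweedler (Δ x) fun x₁ x₂ => F x₁ x₂ z) =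
      sweedler (Δ h) fun x z => sweedler (Δ z) fun z₁ z₂ => F x z₁ z₂ :=
  isCoassoc_comul.sweedler_eq h F h₁ h₂ h₃

theorem sweedler_cocomm (hco : ∀ h : H, TensorProduct.comm k H H (Δ h) = Δ h) (h : H)
    (F : H → H → V) (h₁ : ∀ y, IsLinearMap k fun x => F x y)
    (h₂ : ∀ x, IsLinearMap k fun y => F x y) :
    sweedler (Δ h) F = sweedler (Δ h) fun x y => F y x := by
  conv_lhs => rw [← hco h]
  generalize Δ h = t
  revert t
  refine tensor_eq_of_isLinearMap (isLinearMap_sweedler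
    (isLinearMap_coe (TensorProduct.comm k H H).toLinearMap) _ h₁ h₂) (by fun_prop) fun x y => ?_
  rw [TensorProduct.comm_tmul, sweedler_tmul _ _ _ h₁ h₂,
    sweedler_tmul _ _ _ (by fun_prop) (by fun_prop)]

theorem sweedler_counit (h : H) (F : H → V) (hF : IsLinearMap k F) :
    sweedler (Δ h) (fun x y => Coalgebra.counit (R := k) x • F y) = F h := by
  have key : ∀ t : H ⊗[k] H, sweedler t (fun x y => Coalgebra.counit (R := k) x • F y) =
      sweedler (LinearMap.rTensor H Coalgebra.counit t) (fun (c : k) y => c • F y) := by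
    refine tensor_eq_of_isLinearMap (by fun_prop) (by fun_prop) fun x y => ?_
    rw [LinearMap.rTensor_tmul, sweedler_tmul _ _ _ (by fun_prop) (by fun_prop),
      sweedler_tmul _ _ _ (by fun_prop) (by fun_prop)]
  rw [key, Coalgebra.rTensor_counit_comul, sweedler_tmul _ _ _ (by fun_prop) (by fun_prop),
    one_smul]

theorem sweedler_comul_mul (x y : H) (F : H → H → V) (h₁ : ∀ y, IsLinearMap k fun x => F x y)
    (h₂ : ∀ x, IsLinearMap k fun y => F x y) :
    sweedler (Δ (x * y)) F =
      sweedler (Δ x) fun x₁ x₂ => sweedler (Δ y) fun y₁ y₂ => F (x₁ * y₁) (x₂ * y₂) := by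
  rw [Bialgebra.comul_mul]
  conv_lhs => rw [← sweedler_tmul_self (Δ x), ← sweedler_tmul_self (Δ y)]
  rw [map_sweedler (f := fun t => t * _) (by fun_prop), sweedler_sweedler _ _ _ h₁ h₂]
  congr! 3
  rw [map_sweedler (f := fun t => _ * t) (by fun_prop), sweedler_sweedler _ _ _ h₁ h₂]
  congr! 3
  rw [Algebra.TensorProduct.tmul_mul_tmul, sweedler_tmul _ _ _ h₁ h₂]

theorem sweedler_comul_one (F : H → H → V) (h₁ : ∀ y, IsLinearMap k fun x => F x y)
    (h₂ : ∀ x, IsLinearMap k fun y => F x y) : sweedler (Δ (1 : H)) F = F 1 1 := by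
  rw [Bialgebra.comul_one, Algebra.TensorProduct.one_def, sweedler_tmul _ _ _ h₁ h₂]

theorem sweedler_antipode_mul (h : H) (F : H → V) (hF : IsLinearMap k F) :
    sweedler (Δ h) (fun x y => F (S x * y)) = Coalgebra.counit (R := k) h • F 1 := by
  rw [← map_sweedler hF, ← hF.map_smul, ← Algebra.algebraMap_eq_smul_one,
    ← HopfAlgebra.mul_antipode_rTensor_comul_apply]
  generalize Δ h = t
  congr 1
  revert t
  refine tensor_eq_of_isLinearMap (by fun_prop) (by fun_prop) fun x y => ?_
  rw [sweedler_tmul _ _ _ (by fun_prop) (by fun_prop)]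
  simp

theorem sweedler_mul_antipode (h : H) (F : H → V) (hF : IsLinearMap k F) :
    sweedler (Δ h) (fun x y => F (x * S y)) = Coalgebra.counit (R := k) h • F 1 := by
  rw [← map_sweedler hF, ← hF.map_smul, ← Algebra.algebraMap_eq_smul_one,
    ← HopfAlgebra.mul_antipode_lTensor_comul_apply]
  generalize Δ h = t
  congr 1
  revert t
  refine tensor_eq_of_isLinearMap (by fun_prop) (by fun_prop) fun x y => ?_
  rw [sweedler_tmul _ _ _ (by fun_prop) (by fun_prop)]
  simp

theorem sweedler_mul_counit (h : H) (F : H → V) (hF : IsLinearMap k F) :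
    sweedler (Δ h) (fun x y => Coalgebra.counit (R := k) y • F x) = F h := by
  have key : ∀ t : H ⊗[k] H, sweedler t (fun x y => Coalgebra.counit (R := k) y • F x) =
      sweedler (LinearMap.lTensor H Coalgebra.counit t) (fun y (c : k) => c • F y) := by
    refine tensor_eq_of_isLinearMap (by fun_prop) (by fun_prop) fun x y => ?_
    rw [LinearMap.lTensor_tmul, sweedler_tmul _ _ _ (by fun_prop) (by fun_prop),
      sweedler_tmul _ _ _ (by fun_prop) (by fun_prop)]
  rw [key, Coalgebra.lTensor_counit_comul, sweedler_tmul _ _ _ (by fun_prop) (by fun_prop),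
    one_smul]

/-- The Sweedler form of the axioms of a module algebra used below. -/
structure IsSweedlerAction (rho : H →ₗ[k] A →ₗ[k] A) : Prop where
  apply_mul : ∀ h a b, rho h (a * b) = sweedler (Δ h) fun x y => rho x a * rho y b
  one_apply : ∀ a, rho 1 a = a
  mul_apply : ∀ h l a, rho (h * l) a = rho h (rho l a)

variable {rho : H →ₗ[k] A →ₗ[k] A}

theorem IsSweedlerAction.sweedler_antipode_apply (hr : IsSweedlerAction rho) (h : H) (a b : A) :
    sweedler (Δ h) (fun x y => rho x (sweedler (Δ y) fun p q => rho (S q) a * rho (S p) b)) =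
      Coalgebra.counit (R := k) h • (a * b) := by
  have e₁ : ∀ x y, rho x (sweedler (Δ y) fun p q => rho (S q) a * rho (S p) b) =
      sweedler (Δ x) fun r s => sweedler (Δ y) fun p q =>
        rho (r * S q) a * rho (s * S p) b := fun x y => by
    rw [map_sweedler (isLinearMap_coe (rho x))]
    simp only [hr.apply_mul, hr.mul_apply]
    rw [sweedler_comm]
  have e₂ : ∀ r z, sweedler (Δ z) (fun s w => sweedler (Δ w) fun p q =>
      rho (r * S q) a * rho (s * S p) b) = rho (r * S z) a * b := fun r z => by
    rw [← sweedler_coassoc z (fun s p q => rho (r * S q) a * rho (s * S p) b)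
      (by fun_prop) (by fun_prop) (by fun_prop)]
    have : ∀ m q, sweedler (Δ m) (fun s p => rho (r * S q) a * rho (s * S p) b) =
        Coalgebra.counit (R := k) m • (rho (r * S q) a * b) := fun m q => by
      rw [sweedler_mul_antipode m (fun u => rho (r * S q) a * rho u b) (by fun_prop),
        hr.one_apply]
    simp only [this]
    rw [sweedler_counit z (fun q => rho (r * S q) a * b) (by fun_prop)]
  simp only [e₁]
  rw [sweedler_coassoc h (fun r s y => sweedler (Δ y) fun p q =>
    rho (r * S q) a * rho (s * S p) b) (by fun_prop) (by fun_prop) (by fun_prop)]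
  simp only [e₂]
  rw [sweedler_mul_antipode h (fun u => rho u a * b) (by fun_prop), hr.one_apply]

theorem IsSweedlerAction.antipode_apply_mul (hr : IsSweedlerAction rho) (h : H) (a b : A) :
    rho (S h) (a * b) = sweedler (Δ h) fun x y => rho (S y) a * rho (S x) b := by
  symm
  rw [← sweedler_counit h (fun z => sweedler (Δ z) fun x y => rho (S y) a * rho (S x) b)
    (by fun_prop)]
  have e : ∀ x z, Coalgebra.counit (R := k) x •
      (sweedler (Δ z) fun x y => rho (S y) a * rho (S x) b) =
      sweedler (Δ x) fun x₁ x₂ => rho (S x₁)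
        (rho x₂ (sweedler (Δ z) fun x y => rho (S y) a * rho (S x) b)) := fun x z => by
    simp only [← hr.mul_apply]
    rw [sweedler_antipode_mul x (fun u =>
      rho u (sweedler (Δ z) fun x y => rho (S y) a * rho (S x) b)) (by fun_prop), hr.one_apply]
  simp only [e]
  rw [sweedler_coassoc h (fun x y z => rho (S x)
    (rho y (sweedler (Δ z) fun x y => rho (S y) a * rho (S x) b)))
    (by fun_prop) (by fun_prop) (by fun_prop)]
  simp only [← map_sweedler (isLinearMap_coe (rho (S _))), hr.sweedler_antipode_apply]
  simp only [map_smul]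
  rw [sweedler_mul_counit h (fun x => rho (S x) (a * b)) (by fun_prop)]

theorem IsSweedlerAction.antipode_apply_twisted_mul (hr : IsSweedlerAction rho)
    (hco : ∀ h : H, TensorProduct.comm k H H (Δ h) = Δ h) (g u : H) (a b : A) (Q : H → A → V)
    (hQ₁ : ∀ c, IsLinearMap k fun x => Q x c) (hQ₂ : ∀ x, IsLinearMap k fun c => Q x c) :
    sweedler (Δ g) (fun x y => sweedler (Δ y) fun y₁ y₂ =>
        Q y₂ (rho (S (y₁ * u)) (a * rho x b))) =
      sweedler (Δ g) fun x y => sweedler (Δ u) fun u₁ u₂ =>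
        Q y (rho (S (x * u₂)) a * rho (S u₁) b) := by
  have e₁ : ∀ x y₁ y₂, Q y₂ (rho (S (y₁ * u)) (a * rho x b)) =
      sweedler (Δ y₁) fun r s => sweedler (Δ u) fun u₁ u₂ =>
        Q y₂ (rho (S (s * u₂)) a * rho (S u₁) (rho (S r * x) b)) := fun x y₁ y₂ => by
    rw [hr.antipode_apply_mul, sweedler_comul_mul _ _ _ (by fun_prop) (by fun_prop),
      map_sweedler (hQ₂ _)]
    simp only [map_sweedler (hQ₂ _)]
    congr! 5
    simp only [HopfAlgebra.antipode_mul_antidistrib, hr.mul_apply]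
  have e₂ : ∀ w z, sweedler (Δ w) (fun x r => sweedler (Δ z) fun s t =>
      sweedler (Δ u) fun u₁ u₂ => Q t (rho (S (s * u₂)) a * rho (S u₁) (rho (S r * x) b))) =
      Coalgebra.counit (R := k) w • sweedler (Δ z) fun s t => sweedler (Δ u) fun u₁ u₂ =>
        Q t (rho (S (s * u₂)) a * rho (S u₁) b) := fun w z => by
    rw [sweedler_cocomm hco _ _ (by fun_prop) (by fun_prop),
      sweedler_antipode_mul w (fun v => sweedler (Δ z) fun s t => sweedler (Δ u) fun u₁ u₂ =>
        Q t (rho (S (s * u₂)) a * rho (S u₁) (rho v b))) (by fun_prop)]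
    simp only [hr.one_apply]
  simp only [e₁]
  have e₃ : ∀ x y, sweedler (Δ y) (fun y₁ y₂ => sweedler (Δ y₁) fun r s =>
      sweedler (Δ u) fun u₁ u₂ =>
        Q y₂ (rho (S (s * u₂)) a * rho (S u₁) (rho (S r * x) b))) =
      sweedler (Δ y) fun r z => sweedler (Δ z) fun s t => sweedler (Δ u) fun u₁ u₂ =>
        Q t (rho (S (s * u₂)) a * rho (S u₁) (rho (S r * x) b)) := fun x y => by
    rw [sweedler_coassoc y (fun r s t => sweedler (Δ u) fun u₁ u₂ =>
        Q t (rho (S (s * u₂)) a * rho (S u₁) (rho (S r * x) b)))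
      (by fun_prop) (by fun_prop) (by fun_prop)]
  simp only [e₃]
  rw [← sweedler_coassoc g (fun x r z => sweedler (Δ z) fun s t => sweedler (Δ u) fun u₁ u₂ =>
        Q t (rho (S (s * u₂)) a * rho (S u₁) (rho (S r * x) b)))
      (by fun_prop) (by fun_prop) (by fun_prop)]
  simp only [e₂]
  rw [sweedler_counit g (fun z => sweedler (Δ z) fun s t => sweedler (Δ u) fun u₁ u₂ =>
        Q t (rho (S (s * u₂)) a * rho (S u₁) b)) (by fun_prop)]

/-- The product `g ⊗ h ↦ σ(g⁽²⁾, h⁽²⁾) g⁽¹⁾h⁽¹⁾` twisted by `σ`. -/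
def twistedMul (sg : H →ₗ[k] H →ₗ[k] k) : H ⊗[k] H →ₗ[k] H :=
  TensorProduct.lift (mkBilinear (fun g h => sweedler (Δ g) fun g₁ g₂ => sweedler (Δ h)
    fun h₁ h₂ => sg g₂ h₂ • (g₁ * h₁)) (by fun_prop) (by fun_prop))

variable {sg : H →ₗ[k] H →ₗ[k] k}

theorem twistedMul_tmul (g h : H) : twistedMul sg (g ⊗ₜ h) =
    sweedler (Δ g) fun g₁ g₂ => sweedler (Δ h) fun h₁ h₂ => sg g₂ h₂ • (g₁ * h₁) := rfl

theorem sweedler_comul_twistedMul (g h : H) (F : H → H → V)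
    (h₁ : ∀ y, IsLinearMap k fun x => F x y) (h₂ : ∀ x, IsLinearMap k fun y => F x y) :
    sweedler (Δ (twistedMul sg (g ⊗ₜ h))) F =
      sweedler (Δ g) fun g₁ g₂ => sweedler (Δ h) fun h₁ h₂ =>
        F (g₁ * h₁) (twistedMul sg (g₂ ⊗ₜ h₂)) := by
  have lhs : sweedler (Δ (twistedMul sg (g ⊗ₜ h))) F =
      sweedler (Δ g) fun x z => sweedler (Δ x) fun x₁ x₂ => sweedler (Δ h) fun u w =>
        sweedler (Δ u) fun u₁ u₂ => sg z w • F (x₁ * u₁) (x₂ * u₂) := by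
    rw [twistedMul_tmul, map_sweedler (f := fun t => sweedler (Δ t) F) (by fun_prop)]
    congr! 3 with x z
    rw [map_sweedler (f := fun t => sweedler (Δ t) F) (by fun_prop), sweedler_comm]
    congr! 3 with u w
    rw [(show IsLinearMap k fun t => sweedler (Δ t) F by fun_prop).map_smul,
      sweedler_comul_mul x u F h₁ h₂, map_sweedler (isLinearMap_const_smul isLinearMap_id' _)]
    congr! 3
    rw [map_sweedler (isLinearMap_const_smul isLinearMap_id' _)]
  rw [lhs, sweedler_coassoc g (fun x y z => sweedler (Δ h) fun u w =>
    sweedler (Δ u) fun u₁ u₂ => sg z w • F (x * u₁) (y * u₂))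
    (by fun_prop) (by fun_prop) (by fun_prop)]
  congr! 3 with x z
  have : ∀ z₁ z₂, (sweedler (Δ h) fun u w => sweedler (Δ u) fun u₁ u₂ =>
      sg z₂ w • F (x * u₁) (z₁ * u₂)) = sweedler (Δ h) fun u w => sweedler (Δ w) fun w₁ w₂ =>
      sg z₂ w₂ • F (x * u) (z₁ * w₁) := fun z₁ z₂ => by
    rw [sweedler_coassoc h (fun u w w' => sg z₂ w' • F (x * u) (z₁ * w))
      (by fun_prop) (by fun_prop) (by fun_prop)]
  simp only [this]
  rw [sweedler_comm]
  congr! 3 with u w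
  rw [twistedMul_tmul, map_sweedler (h₂ _)]
  congr! 3
  rw [map_sweedler (h₂ _)]
  congr! 3
  rw [(h₂ _).map_smul]

/-- The computation behind the compatibility of `Φ` with the `0`-th face. -/
theorem IsSweedlerAction.sweedler_crossedMul (hr : IsSweedlerAction rho)
    (hco : ∀ h : H, TensorProduct.comm k H H (Δ h) = Δ h) (g h p : H) (a b : A) (Q : H → A → V)
    (hQ₁ : ∀ c, IsLinearMap k fun x => Q x c) (hQ₂ : ∀ x, IsLinearMap k fun c => Q x c) :
    sweedler (Δ g) (fun x y => sweedler (Δ (twistedMul sg (y ⊗ₜ h))) fun w₁ w₂ =>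
        Q w₂ (rho (S (w₁ * p)) (a * rho x b))) =
      sweedler (Δ h) fun h₁ h' => sweedler (Δ h') fun h₂ h₃ => sweedler (Δ p) fun p₁ p₂ =>
        sweedler (Δ g) fun x y =>
          Q (twistedMul sg (y ⊗ₜ h₃)) (rho (S (x * (h₂ * p₂))) a * rho (S (h₁ * p₁)) b) := by
  have e₁ : ∀ x y, sweedler (Δ (twistedMul sg (y ⊗ₜ h))) (fun w₁ w₂ =>
      Q w₂ (rho (S (w₁ * p)) (a * rho x b))) = sweedler (Δ h) fun h₁ h₂ =>
      sweedler (Δ y) fun y₁ y₂ =>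
        Q (twistedMul sg (y₂ ⊗ₜ h₂)) (rho (S (y₁ * (h₁ * p))) (a * rho x b)) := fun x y => by
    rw [sweedler_comul_twistedMul _ _ _ (by fun_prop) (by fun_prop), sweedler_comm]
    simp only [mul_assoc]
  simp only [e₁]
  rw [sweedler_comm]
  have e₂ : ∀ h₁ h₂, (sweedler (Δ g) fun x y => sweedler (Δ y) fun y₁ y₂ =>
      Q (twistedMul sg (y₂ ⊗ₜ h₂)) (rho (S (y₁ * (h₁ * p))) (a * rho x b))) =
      sweedler (Δ h₁) fun q r => sweedler (Δ p) fun p₁ p₂ => sweedler (Δ g) fun x y =>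
        Q (twistedMul sg (y ⊗ₜ h₂)) (rho (S (x * (r * p₂))) a * rho (S (q * p₁)) b) :=
    fun h₁ h₂ => by
    rw [hr.antipode_apply_twisted_mul hco g (h₁ * p) a b
      (fun y c => Q (twistedMul sg (y ⊗ₜ h₂)) c) (by fun_prop) (by fun_prop),
      sweedler_comm, sweedler_comul_mul _ _ _ (by fun_prop) (by fun_prop)]
  simp only [e₂]
  rw [sweedler_coassoc h (fun h₁ h₂ h₃ => sweedler (Δ p) fun p₁ p₂ => sweedler (Δ g) fun x y =>
    Q (twistedMul sg (y ⊗ₜ h₃)) (rho (S (x * (h₂ * p₂))) a * rho (S (h₁ * p₁)) b))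
    (by fun_prop) (by fun_prop) (by fun_prop)]

/-- The diagonal coaction `h ⊗ n ↦ h⁽¹⁾n⁽⁻¹⁾ ⊗ (h⁽²⁾ ⊗ n⁽⁰⁾)` on `H ⊗ N`. -/
def diagCoaction (c : N →ₗ[k] H ⊗[k] N) : H ⊗[k] N →ₗ[k] H ⊗[k] (H ⊗[k] N) :=
  TensorProduct.lift (mkBilinear (fun h n => sweedler (Δ h) fun x y => sweedler (c n)
    fun p m => (x * p) ⊗ₜ (y ⊗ₜ m)) (by fun_prop) (by fun_prop))

theorem diagCoaction_tmul (c : N →ₗ[k] H ⊗[k] N) (h : H) (n : N) :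
    diagCoaction c (h ⊗ₜ n) = sweedler (Δ h) fun x y => sweedler (c n) fun p m =>
      (x * p) ⊗ₜ (y ⊗ₜ m) := rfl

theorem sweedler_diagCoaction (c : N →ₗ[k] H ⊗[k] N) (h : H) (n : N) (F : H → H ⊗[k] N → V)
    (h₁ : ∀ y, IsLinearMap k fun x => F x y) (h₂ : ∀ x, IsLinearMap k fun y => F x y) :
    sweedler (diagCoaction c (h ⊗ₜ n)) F =
      sweedler (Δ h) fun x y => sweedler (c n) fun p m => F (x * p) (y ⊗ₜ m) := by
  rw [diagCoaction_tmul, sweedler_sweedler _ _ _ h₁ h₂]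
  congr! 3
  rw [sweedler_sweedler _ _ _ h₁ h₂]
  congr! 3
  rw [sweedler_tmul _ _ _ h₁ h₂]

theorem map_lTensor_sweedler {N' : Type*} [AddCommMonoid N'] [Module k N'] (E : N →ₗ[k] N')
    (t : H ⊗[k] N) : LinearMap.lTensor H E t = sweedler t fun p m => p ⊗ₜ E m := by
  conv_lhs => rw [← sweedler_tmul_self t]
  rw [map_sweedler (isLinearMap_coe _)]
  simp only [LinearMap.lTensor_tmul]

theorem isCoassoc_iff {c : N →ₗ[k] H ⊗[k] N} : IsCoassoc c ↔
    ∀ n, sweedler (c n) (fun x m => sweedler (Δ x) fun x₁ x₂ => x₁ ⊗ₜ[k] (x₂ ⊗ₜ[k] m)) =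
      sweedler (c n) fun x m => x ⊗ₜ[k] (c m) := by
  refine forall_congr' fun n => ?_
  rw [map_lTensor_sweedler]
  have : ∀ t, TensorProduct.assoc k H H N (LinearMap.rTensor N Coalgebra.comul t) =
      sweedler t fun x m => sweedler (Δ x) fun x₁ x₂ => x₁ ⊗ₜ[k] (x₂ ⊗ₜ[k] m) := by
    refine tensor_eq_of_isLinearMap (isLinearMap_comp
      (isLinearMap_coe (TensorProduct.assoc k H H N).toLinearMap) (by fun_prop)) (by fun_prop)
      fun x m => ?_
    rw [LinearMap.rTensor_tmul, sweedler_tmul _ _ _ (by fun_prop) (by fun_prop)]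
    conv_lhs => rw [← sweedler_tmul_self (Δ x)]
    rw [map_sweedler (f := fun t => TensorProduct.assoc k H H N (t ⊗ₜ m)) (isLinearMap_comp
      (isLinearMap_coe (TensorProduct.assoc k H H N).toLinearMap) (by fun_prop))]
    simp only [TensorProduct.assoc_tmul]
  rw [this]

theorem IsCoassoc.diagCoaction {c : N →ₗ[k] H ⊗[k] N} (hc : IsCoassoc c) :
    IsCoassoc (diagCoaction c) := by
  refine isCoassoc_iff.2 (tensor_eq_of_isLinearMap (by fun_prop) (by fun_prop) fun h n => ?_)
  rw [sweedler_diagCoaction _ _ _ _ (by fun_prop) (by fun_prop),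
    sweedler_diagCoaction _ _ _ _ (by fun_prop) (by fun_prop)]
  have e : ∀ x y : H, sweedler (c n) (fun p m => sweedler (Δ (x * p)) fun (u v : H) =>
      u ⊗ₜ[k] (v ⊗ₜ[k] (y ⊗ₜ[k] m))) = sweedler (Δ x) fun x₁ x₂ => sweedler (c n) fun p m =>
      sweedler (Δ p) fun p₁ p₂ => (x₁ * p₁) ⊗ₜ[k] ((x₂ * p₂) ⊗ₜ[k] (y ⊗ₜ[k] m)) := fun x y => by
    rw [sweedler_comm]
    congr! 3
    rw [sweedler_comul_mul _ _ _ (by fun_prop) (by fun_prop)]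
  simp only [e]
  rw [sweedler_coassoc h (fun x₁ x₂ y => sweedler (c n) fun p m =>
      sweedler (Δ p) fun p₁ p₂ => (x₁ * p₁) ⊗ₜ[k] ((x₂ * p₂) ⊗ₜ[k] (y ⊗ₜ[k] m)))
      (by fun_prop) (by fun_prop) (by fun_prop)]
  congr! 3 with x y
  have e' : ∀ y₁ y₂ : H, sweedler (c n) (fun p m =>
      sweedler (Δ p) fun p₁ p₂ => (x * p₁) ⊗ₜ[k] ((y₁ * p₂) ⊗ₜ[k] (y₂ ⊗ₜ[k] m))) =
      sweedler (c n) fun p m => sweedler (c m) fun q m' =>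
        (x * p) ⊗ₜ[k] ((y₁ * q) ⊗ₜ[k] (y₂ ⊗ₜ[k] m')) := fun y₁ y₂ =>
    hc.sweedler_eq n (fun p q m => (x * p) ⊗ₜ[k] ((y₁ * q) ⊗ₜ[k] (y₂ ⊗ₜ[k] m)))
      (by fun_prop) (by fun_prop) (by fun_prop)
  simp only [e']
  rw [sweedler_comm]
  congr! 3 with p m
  rw [diagCoaction_tmul, map_sweedler (isLinearMap_const_tmul isLinearMap_id' _)]
  congr! 3
  rw [map_sweedler (isLinearMap_const_tmul isLinearMap_id' _)]

section Comodule

variable {N' W' : Type*} [AddCommMonoid N'] [Module k N'] [AddCommMonoid W'] [Module k W']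

/-- `E` is a morphism of left comodules. -/
def IsComoduleMap (c : N →ₗ[k] H ⊗[k] N) (c' : N' →ₗ[k] H ⊗[k] N') (E : N →ₗ[k] N') : Prop :=
  ∀ n, c' (E n) = LinearMap.lTensor H E (c n)

theorem IsComoduleMap.sweedler_eq {c : N →ₗ[k] H ⊗[k] N} {c' : N' →ₗ[k] H ⊗[k] N'}
    {E : N →ₗ[k] N'} (hE : IsComoduleMap c c' E) (n : N) (F : H → N' → V)
    (h₁ : ∀ y, IsLinearMap k fun x => F x y) (h₂ : ∀ x, IsLinearMap k fun y => F x y) :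
    sweedler (c' (E n)) F = sweedler (c n) fun p m => F p (E m) := by
  rw [hE, map_lTensor_sweedler, sweedler_sweedler _ _ _ h₁ h₂]
  congr! 3
  rw [sweedler_tmul _ _ _ h₁ h₂]

theorem IsComoduleMap.lTensor {c : N →ₗ[k] H ⊗[k] N} {c' : N' →ₗ[k] H ⊗[k] N'}
    {E : N →ₗ[k] N'} (hE : IsComoduleMap c c' E) :
    IsComoduleMap (diagCoaction c) (diagCoaction c') (LinearMap.lTensor H E) := by
  refine tensor_eq_of_isLinearMap (by fun_prop) (by fun_prop) fun h n => ?_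
  rw [LinearMap.lTensor_tmul, diagCoaction_tmul, map_lTensor_sweedler,
    sweedler_diagCoaction _ _ _ _ (by fun_prop) (by fun_prop)]
  congr! 3
  rw [hE.sweedler_eq _ _ (by fun_prop) (by fun_prop)]
  simp only [LinearMap.lTensor_tmul]

theorem isComoduleMap_twistedMul :
    IsComoduleMap (diagCoaction (Coalgebra.comul (R := k))) (Coalgebra.comul (R := k))
      (twistedMul sg) := by
  refine tensor_eq_of_isLinearMap (by fun_prop) (by fun_prop) fun g h => ?_
  rw [map_lTensor_sweedler, sweedler_diagCoaction _ _ _ _ (by fun_prop) (by fun_prop),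
    ← sweedler_tmul_self (Δ (twistedMul sg (g ⊗ₜ h))),
    sweedler_comul_twistedMul _ _ _ (by fun_prop) (by fun_prop)]

/-- Apply `f` to the first two factors of `V ⊗ (V ⊗ T)`. -/
def mapFirstTwo (f : V ⊗[k] V →ₗ[k] V) (T : Type*) [AddCommMonoid T] [Module k T] :
    V ⊗[k] (V ⊗[k] T) →ₗ[k] V ⊗[k] T :=
  LinearMap.rTensor T f ∘ₗ (TensorProduct.assoc k V V T).symm.toLinearMap

@[simp]
theorem mapFirstTwo_tmul (f : V ⊗[k] V →ₗ[k] V) (v w : V) (t : W) :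
    mapFirstTwo f W (v ⊗ₜ (w ⊗ₜ t)) = f (v ⊗ₜ w) ⊗ₜ t := by
  simp [mapFirstTwo]

theorem isComoduleMap_mapFirstTwo (c : N →ₗ[k] H ⊗[k] N) :
    IsComoduleMap (diagCoaction (diagCoaction c)) (diagCoaction c)
      (mapFirstTwo (twistedMul sg) N) := by
  refine tensor_eq_of_isLinearMap (by fun_prop) (by fun_prop) fun g t => ?_
  revert t
  refine tensor_eq_of_isLinearMap (by fun_prop) (by fun_prop) fun h n => ?_
  rw [mapFirstTwo_tmul, diagCoaction_tmul,
    sweedler_comul_twistedMul _ _ _ (by fun_prop) (by fun_prop), map_lTensor_sweedler,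
    sweedler_diagCoaction _ _ _ _ (by fun_prop) (by fun_prop)]
  congr! 3
  rw [sweedler_diagCoaction _ _ _ _ (by fun_prop) (by fun_prop)]
  simp only [mapFirstTwo_tmul, mul_assoc]

/-- The map `(a ⊗ g) ⊗ (n ⊗ w) ↦ (g⁽²⁾ ⊗ n⁽⁰⁾) ⊗ (S(g⁽¹⁾n⁽⁻¹⁾)(a) ⊗ w)`. -/
def phiStep (rho : H →ₗ[k] A →ₗ[k] A) (c : N →ₗ[k] H ⊗[k] N) (W : Type*) [AddCommMonoid W]
    [Module k W] : (A ⊗[k] H) ⊗[k] (N ⊗[k] W) →ₗ[k] (H ⊗[k] N) ⊗[k] (A ⊗[k] W) :=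
  TensorProduct.lift (TensorProduct.lift (mkBilinear (fun a g => TensorProduct.lift
    (mkBilinear (fun n w => sweedler (Δ g) fun x y => sweedler (c n) fun p m =>
      (y ⊗ₜ m) ⊗ₜ (rho (S (x * p)) a ⊗ₜ w)) (by fun_prop) (by fun_prop)))
    (fun g => ⟨fun a a' => by
        ext n w
        exact (show IsLinearMap k fun a => sweedler (Δ g) fun x y => sweedler (c n) fun p m =>
          (y ⊗ₜ[k] m) ⊗ₜ[k] (rho (S (x * p)) a ⊗ₜ[k] w) by fun_prop).map_add a a',
      fun r a => by
        ext n w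
        exact (show IsLinearMap k fun a => sweedler (Δ g) fun x y => sweedler (c n) fun p m =>
          (y ⊗ₜ[k] m) ⊗ₜ[k] (rho (S (x * p)) a ⊗ₜ[k] w) by fun_prop).map_smul r a⟩)
    (fun a => ⟨fun g g' => by
        ext n w
        exact (show IsLinearMap k fun g => sweedler (Δ g) fun x y => sweedler (c n) fun p m =>
          (y ⊗ₜ[k] m) ⊗ₜ[k] (rho (S (x * p)) a ⊗ₜ[k] w) by fun_prop).map_add g g',
      fun r g => by
        ext n w
        exact (show IsLinearMap k fun g => sweedler (Δ g) fun x y => sweedler (c n) fun p m =>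
          (y ⊗ₜ[k] m) ⊗ₜ[k] (rho (S (x * p)) a ⊗ₜ[k] w) by fun_prop).map_smul r g⟩)))

theorem phiStep_tmul (c : N →ₗ[k] H ⊗[k] N) (a : A) (g : H) (n : N) (w : W) :
    phiStep rho c W ((a ⊗ₜ g) ⊗ₜ (n ⊗ₜ w)) = sweedler (Δ g) fun x y =>
      sweedler (c n) fun p m => (y ⊗ₜ m) ⊗ₜ (rho (S (x * p)) a ⊗ₜ w) := rfl

/-- The map `a ⊗ g ↦ g⁽²⁾ ⊗ S(g⁽¹⁾)(a)`. -/
def phiZero (rho : H →ₗ[k] A →ₗ[k] A) : A ⊗[k] H →ₗ[k] H ⊗[k] A :=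
  TensorProduct.lift (mkBilinear (fun a g => sweedler (Δ g) fun x y => y ⊗ₜ rho (S x) a)
    (by fun_prop) (by fun_prop))

theorem phiZero_tmul (a : A) (g : H) :
    phiZero rho (a ⊗ₜ g) = sweedler (Δ g) fun x y => y ⊗ₜ rho (S x) a := rfl

theorem phiStep_map {c : N →ₗ[k] H ⊗[k] N} {c' : N' →ₗ[k] H ⊗[k] N'} {E : N →ₗ[k] N'}
    (hE : IsComoduleMap c c' E) (m : W →ₗ[k] W') (x : A ⊗[k] H) (t : N ⊗[k] W) :
    phiStep rho c' W' (x ⊗ₜ TensorProduct.map E m t) =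
      TensorProduct.map (LinearMap.lTensor H E) (LinearMap.lTensor A m)
        (phiStep rho c W (x ⊗ₜ t)) := by
  revert t
  refine tensor_eq_of_isLinearMap (by fun_prop) (by fun_prop) fun n w => ?_
  revert x
  refine tensor_eq_of_isLinearMap (by fun_prop) (by fun_prop) fun a g => ?_
  rw [TensorProduct.map_tmul, phiStep_tmul, phiStep_tmul, map_sweedler (isLinearMap_coe _)]
  congr! 3
  rw [map_sweedler (isLinearMap_coe _), hE.sweedler_eq _ _ (by fun_prop) (by fun_prop)]
  simp only [TensorProduct.map_tmul, LinearMap.lTensor_tmul]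

/-- The product `(a ⊗ g)(b ⊗ h) = a g⁽¹⁾(b) ⊗ g⁽²⁾ · h`, with `·` the twisted product. -/
def IsSweedlerCrossedMul (rho : H →ₗ[k] A →ₗ[k] A) (sg : H →ₗ[k] H →ₗ[k] k)
    (mul : (A ⊗[k] H) ⊗[k] (A ⊗[k] H) →ₗ[k] A ⊗[k] H) : Prop :=
  ∀ a g b h, mul ((a ⊗ₜ g) ⊗ₜ (b ⊗ₜ h)) =
    sweedler (Δ g) fun x y => (a * rho x b) ⊗ₜ twistedMul sg (y ⊗ₜ h)

variable {mul : (A ⊗[k] H) ⊗[k] (A ⊗[k] H) →ₗ[k] A ⊗[k] H}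

theorem IsSweedlerCrossedMul.phiZero_mul (hm : IsSweedlerCrossedMul rho sg mul)
    (hr : IsSweedlerAction rho) (hco : ∀ h : H, TensorProduct.comm k H H (Δ h) = Δ h)
    (x y : A ⊗[k] H) :
    phiZero rho (mul (x ⊗ₜ y)) =
      TensorProduct.map (twistedMul sg) (LinearMap.mul' k A)
        (phiStep rho (Coalgebra.comul (R := k)) A (x ⊗ₜ phiZero rho y)) := by
  revert y
  refine tensor_eq_of_isLinearMap (by fun_prop) (by fun_prop) fun b h => ?_
  revert x
  refine tensor_eq_of_isLinearMap (by fun_prop) (by fun_prop) fun a g => ?_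
  have key := hr.sweedler_crossedMul (sg := sg) hco g h 1 a b (fun x c => x ⊗ₜ[k] c)
    (by fun_prop) (by fun_prop)
  simp only [mul_one] at key
  rw [hm, map_sweedler (isLinearMap_coe _)]
  simp only [phiZero_tmul]
  rw [key, map_sweedler (f := fun t => TensorProduct.map (twistedMul sg) (LinearMap.mul' k A)
    (phiStep rho Coalgebra.comul A ((a ⊗ₜ[k] g) ⊗ₜ[k] t))) (by fun_prop)]
  congr! 3 with h₁ h'
  have e : ∀ h₂ h₃ : H, (sweedler (Δ (1 : H)) fun p₁ p₂ => sweedler (Δ g) fun x y =>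
      twistedMul sg (y ⊗ₜ h₃) ⊗ₜ[k] (rho (S (x * (h₂ * p₂))) a * rho (S (h₁ * p₁)) b)) =
      sweedler (Δ g) fun x y =>
      twistedMul sg (y ⊗ₜ h₃) ⊗ₜ[k] (rho (S (x * h₂)) a * rho (S h₁) b) := fun h₂ h₃ => by
    rw [sweedler_comul_one _ (by fun_prop) (by fun_prop)]
    simp only [mul_one]
  simp only [e]
  rw [phiStep_tmul, sweedler_comm, map_sweedler (isLinearMap_coe _)]
  congr! 3
  rw [map_sweedler (isLinearMap_coe _)]
  simp only [TensorProduct.map_tmul, LinearMap.mul'_apply]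

theorem IsSweedlerCrossedMul.phiStep_mul (hm : IsSweedlerCrossedMul rho sg mul)
    (hr : IsSweedlerAction rho) (hco : ∀ h : H, TensorProduct.comm k H H (Δ h) = Δ h)
    {c : N →ₗ[k] H ⊗[k] N} (hc : IsCoassoc c) (x y : A ⊗[k] H) (t : N ⊗[k] W) :
    phiStep rho c W (mul (x ⊗ₜ y) ⊗ₜ t) =
      TensorProduct.map (mapFirstTwo (twistedMul sg) N) (mapFirstTwo (LinearMap.mul' k A) W)
        (phiStep rho (diagCoaction c) (A ⊗[k] W) (x ⊗ₜ phiStep rho c W (y ⊗ₜ t))) := by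
  revert t
  refine tensor_eq_of_isLinearMap (by fun_prop) (by fun_prop) fun n w => ?_
  revert y
  refine tensor_eq_of_isLinearMap (by fun_prop) (by fun_prop) fun b h => ?_
  revert x
  refine tensor_eq_of_isLinearMap (by fun_prop) (by fun_prop) fun a g => ?_
  rw [hm, map_sweedler (f := fun s => phiStep rho c W (s ⊗ₜ[k] (n ⊗ₜ[k] w))) (by fun_prop)]
  simp only [phiStep_tmul]
  have e : ∀ x y, (sweedler (Δ (twistedMul sg (y ⊗ₜ h))) fun u v => sweedler (c n) fun p m =>
      (v ⊗ₜ[k] m) ⊗ₜ[k] (rho (S (u * p)) (a * rho x b) ⊗ₜ[k] w)) =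
      sweedler (c n) fun p m => sweedler (Δ (twistedMul sg (y ⊗ₜ h))) fun u v =>
      (v ⊗ₜ[k] m) ⊗ₜ[k] (rho (S (u * p)) (a * rho x b) ⊗ₜ[k] w) := fun x y => by
    rw [sweedler_comm]
  simp only [e]
  rw [sweedler_comm]
  have key := fun (p : H) (m : N) => hr.sweedler_crossedMul (sg := sg) hco g h p a b
    (fun x c => (x ⊗ₜ[k] m) ⊗ₜ[k] (c ⊗ₜ[k] w)) (by fun_prop) (by fun_prop)
  simp only [key]
  rw [sweedler_comm, map_sweedler (f := fun t => TensorProduct.map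
    (mapFirstTwo (twistedMul sg) N) (mapFirstTwo (LinearMap.mul' k A) W)
    (phiStep rho (diagCoaction c) (A ⊗[k] W) ((a ⊗ₜ[k] g) ⊗ₜ[k] t))) (by fun_prop)]
  congr! 3 with h₁ h'
  have e₂ : (sweedler (c n) fun p m => sweedler (Δ h') fun h₂ h₃ => sweedler (Δ p) fun p₁ p₂ =>
      sweedler (Δ g) fun x y => (twistedMul sg (y ⊗ₜ h₃) ⊗ₜ[k] m) ⊗ₜ[k]
        ((rho (S (x * (h₂ * p₂))) a * rho (S (h₁ * p₁)) b) ⊗ₜ[k] w)) =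
      sweedler (c n) fun p m => sweedler (c m) fun q m' => sweedler (Δ h') fun h₂ h₃ =>
      sweedler (Δ g) fun x y => (twistedMul sg (y ⊗ₜ h₃) ⊗ₜ[k] m') ⊗ₜ[k]
        ((rho (S (x * (h₂ * q))) a * rho (S (h₁ * p)) b) ⊗ₜ[k] w) := by
    rw [← hc.sweedler_eq n (fun p q m' => sweedler (Δ h') fun h₂ h₃ =>
      sweedler (Δ g) fun x y => (twistedMul sg (y ⊗ₜ h₃) ⊗ₜ[k] m') ⊗ₜ[k]
        ((rho (S (x * (h₂ * q))) a * rho (S (h₁ * p)) b) ⊗ₜ[k] w))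
      (by fun_prop) (by fun_prop) (by fun_prop)]
    congr! 3
    rw [sweedler_comm]
  rw [e₂, map_sweedler (f := fun t => TensorProduct.map
    (mapFirstTwo (twistedMul sg) N) (mapFirstTwo (LinearMap.mul' k A) W)
    (phiStep rho (diagCoaction c) (A ⊗[k] W) ((a ⊗ₜ[k] g) ⊗ₜ[k] t))) (by fun_prop)]
  congr! 3 with p m
  rw [phiStep_tmul, map_sweedler (isLinearMap_coe _)]
  have e₃ : ∀ x y : H, sweedler (diagCoaction c (h' ⊗ₜ[k] m)) (fun q t => (y ⊗ₜ[k] t) ⊗ₜ[k]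
      (rho (S (x * q)) a ⊗ₜ[k] (rho (S (h₁ * p)) b ⊗ₜ[k] w))) =
      sweedler (Δ h') fun h₂ h₃ => sweedler (c m) fun q m' => (y ⊗ₜ[k] (h₃ ⊗ₜ[k] m')) ⊗ₜ[k]
      (rho (S (x * (h₂ * q))) a ⊗ₜ[k] (rho (S (h₁ * p)) b ⊗ₜ[k] w)) := fun x y => by
    rw [sweedler_diagCoaction _ _ _ _ (by fun_prop) (by fun_prop)]
  simp only [e₃, map_sweedler (isLinearMap_coe (TensorProduct.map
    (mapFirstTwo (twistedMul sg) N) (mapFirstTwo (LinearMap.mul' k A) W))),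
    TensorProduct.map_tmul, mapFirstTwo_tmul, LinearMap.mul'_apply]
  rw [sweedler_comm (c m)]
  conv_rhs => rw [sweedler_comm]
  congr! 3
  rw [sweedler_comm]

end Comodule

end Hopf

section MergeAt

variable {V : Type}

theorem mergeAt_zero {n : ℕ} (x : Fin (n + 2) → V) (v : V) :
    mergeAt 0 x v = Fin.cons v fun j => x j.succ.succ := by
  funext j
  refine Fin.cases ?_ (fun j => ?_) j <;> simp [mergeAt]

theorem mergeAt_succ {n : ℕ} (i : Fin n) (x : Fin (n + 2) → V) (v : V) :
    mergeAt i.succ x v = Fin.cons (x 0) (mergeAt i (fun j => x j.succ) v) := by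
  funext j
  refine Fin.cases ?_ (fun j => ?_) j
  · simp [mergeAt]
  · simp [mergeAt, Fin.castSucc_succ]

end MergeAt

section TensorPower

variable {k : Type} [Field k] {V : Type} [AddCommGroup V] [Module k V]
  {P : Type*} [AddCommMonoid P] [Module k P]

theorem tpow_ext {s : Set V} (hs : Submodule.span k s = ⊤) {n : ℕ} {f g : Tpow k V n →ₗ[k] P}
    (h : ∀ x : Fin (n + 1) → V, (∀ i, x i ∈ s) → f (tpow k V n x) = g (tpow k V n x)) :
    f = g := by
  induction n generalizing P with
  | zero => exact LinearMap.ext_on (M := V) hs fun v hv => h (fun _ => v) fun _ => hv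
  | succ n ih =>
    refine TensorProduct.ext (M := V) (N := Tpow k V n) (LinearMap.ext_on hs fun v hv => ?_)
    refine ih fun x hx => ?_
    exact h (Fin.cons v x) fun i => Fin.cases hv hx i

/-- Apply `f` to the factors `i` and `i + 1` of `V ⊗ ⋯ ⊗ V`. -/
def mergeMap (f : V ⊗[k] V →ₗ[k] V) : (n : ℕ) → Fin (n + 1) → (Tpow k V (n + 1) →ₗ[k] Tpow k V n)
  | 0, _ => f
  | n + 1, i => Fin.cases (mapFirstTwo f (Tpow k V n) :)
      (fun j => (LinearMap.lTensor V (mergeMap f n j) :)) i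

theorem mergeMap_tpow (f : V ⊗[k] V →ₗ[k] V) {n : ℕ} (i : Fin (n + 1)) (x : Fin (n + 2) → V) :
    mergeMap f n i (tpow k V (n + 1) x) =
      tpow k V n (mergeAt i x (f (x i.castSucc ⊗ₜ x i.succ))) := by
  induction n with
  | zero =>
    rw [Fin.fin_one_eq_zero i, mergeAt_zero]
    rfl
  | succ n ih =>
    refine Fin.cases ?_ (fun j => ?_) i
    · rw [mergeAt_zero]
      exact mapFirstTwo_tmul f (W := Tpow k V n) _ _ _
    · rw [mergeAt_succ]
      exact congrArg (fun t => (x 0 ⊗ₜ[k] t : V ⊗[k] Tpow k V n)) (ih j fun i => x i.succ)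

theorem tpow_mergeAt_isLinearMap {n : ℕ} (i : Fin (n + 1)) (x : Fin (n + 2) → V) :
    IsLinearMap k fun v => tpow k V n (mergeAt i x v) := by
  induction n with
  | zero =>
    rw [Fin.fin_one_eq_zero i]
    simp only [mergeAt_zero]
    exact isLinearMap_id'
  | succ n ih =>
    refine Fin.cases ?_ (fun j => ?_) i
    · simp only [mergeAt_zero, tpow, Fin.cons_zero, Fin.cons_succ]
      exact isLinearMap_tmul_const (N := V) (P := Tpow k V n) isLinearMap_id' _
    · simp only [mergeAt_succ]
      exact isLinearMap_const_tmul (N := Tpow k V n) (P := V) (ih j fun i => x i.succ) _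

theorem tpow_update_zero_smul {n : ℕ} (x : Fin (n + 1) → V) (c : k) :
    tpow k V n (Function.update x 0 (c • x 0)) = c • tpow k V n x := by
  cases n with
  | zero =>
    simp only [tpow, Function.update_self]
    rfl
  | succ n =>
    simp only [tpow, Function.update_self, ne_eq, Fin.succ_ne_zero, not_false_eq_true,
      Function.update_of_ne]
    rfl

end TensorPower

section Recursion

variable {k : Type} [Field k] {H : Type} [Ring H] [HopfAlgebra k H] {A : Type} [Ring A]
  [Algebra k A]

/-- The diagonal coaction of `H` on `H ⊗ ⋯ ⊗ H`. -/
def tpowCoaction (k : Type) [Field k] (H : Type) [Ring H] [HopfAlgebra k H] :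
    (n : ℕ) → Tpow k H n →ₗ[k] H ⊗[k] Tpow k H n
  | 0 => (Coalgebra.comul : H →ₗ[k] H ⊗[k] H)
  | n + 1 => (diagCoaction (tpowCoaction k H n) :)

/-- The map `Φ`, defined by recursion on the number of tensor factors. -/
def phiRec (rho : H →ₗ[k] A →ₗ[k] A) :
    (n : ℕ) → Tpow k (A ⊗[k] H) n →ₗ[k] (Tpow k H n) ⊗[k] (Tpow k A n)
  | 0 => phiZero rho
  | n + 1 => (phiStep rho (tpowCoaction k H n) (Tpow k A n) ∘ₗ
      LinearMap.lTensor (A ⊗[k] H) (phiRec rho n) :)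

theorem isCoassoc_tpowCoaction (n : ℕ) : IsCoassoc (tpowCoaction k H n) := by
  induction n with
  | zero => exact isCoassoc_comul
  | succ n ih => exact ih.diagCoaction

theorem isComoduleMap_mergeMap (sg : H →ₗ[k] H →ₗ[k] k) {n : ℕ} (i : Fin (n + 1)) :
    IsComoduleMap (tpowCoaction k H (n + 1)) (tpowCoaction k H n)
      (mergeMap (twistedMul sg) n i) := by
  induction n with
  | zero => exact isComoduleMap_twistedMul
  | succ n ih =>
    refine Fin.cases ?_ (fun j => ?_) i
    · exact isComoduleMap_mapFirstTwo (tpowCoaction k H n)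
    · exact (ih j).lTensor

theorem phiRec_comp_mergeMap {rho : H →ₗ[k] A →ₗ[k] A} {sg : H →ₗ[k] H →ₗ[k] k}
    {mul : (A ⊗[k] H) ⊗[k] (A ⊗[k] H) →ₗ[k] A ⊗[k] H}
    (hm : IsSweedlerCrossedMul rho sg mul) (hr : IsSweedlerAction rho) (hco : Cocomm k H)
    {n : ℕ} (i : Fin (n + 1)) :
    phiRec rho n ∘ₗ mergeMap mul n i =
      TensorProduct.map (mergeMap (twistedMul sg) n i) (mergeMap (LinearMap.mul' k A) n i) ∘ₗ
        phiRec rho (n + 1) := by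
  induction n with
  | zero => exact TensorProduct.ext' fun x y => hm.phiZero_mul hr hco x y
  | succ n ih =>
    refine Fin.cases ?_ (fun j => ?_) i
    · refine TensorProduct.ext (LinearMap.ext fun x => TensorProduct.ext' fun y t => ?_)
      exact hm.phiStep_mul hr hco (isCoassoc_tpowCoaction n) x y (phiRec rho n t)
    · refine TensorProduct.ext' fun x t => ?_
      have := phiStep_map (rho := rho) (isComoduleMap_mergeMap sg j)
        (mergeMap (LinearMap.mul' k A) n j) x (phiRec rho (n + 1) t)
      rw [← LinearMap.comp_apply, ← ih] at this
      exact this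

end Recursion

section IterRepr

variable {k : Type} [Field k] {H : Type} [Ring H] [HopfAlgebra k H]
  {V : Type*} [AddCommMonoid V] [Module k V]

theorem IterRepr.sum_eq_sweedler_sweedler {h : H} (R : IterRepr k H 2 h) (F : H → H → H → V)
    (h₁ : ∀ y z, IsLinearMap k fun x => F x y z) (h₂ : ∀ x z, IsLinearMap k fun y => F x y z)
    (h₃ : ∀ x y, IsLinearMap k fun z => F x y z) :
    ∑ i ∈ R.s, F (R.leg i 0) (R.leg i 1) (R.leg i 2) =
      sweedler (Coalgebra.comul (R := k) h) fun x y => sweedler (Coalgebra.comul (R := k) y)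
        (F x) := by
  have e : ∑ i ∈ R.s, (R.leg i 0 ⊗ₜ[k] (R.leg i 1 ⊗ₜ[k] R.leg i 2)) =
      LinearMap.lTensor H (LinearMap.lTensor H LinearMap.id ∘ₗ Coalgebra.comul)
        (Coalgebra.comul (R := k) h) := R.eq
  have key := congrArg (fun t => sweedler t fun x s => sweedler s (F x)) e
  rw [sweedler_sum _ _ _ (by fun_prop) (by fun_prop), map_lTensor_sweedler,
    sweedler_sweedler _ _ _ (by fun_prop) (by fun_prop)] at key
  simp only [LinearMap.lTensor_id, LinearMap.id_comp] at key
  have e₁ : ∀ x t, sweedler (x ⊗ₜ[k] t) (fun x s => sweedler s (F x)) = sweedler t (F x) :=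
    fun x t => sweedler_tmul _ _ _ (by fun_prop) (by fun_prop)
  simp only [e₁, sweedler_tmul _ _ _ (h₂ _) (h₃ _)] at key
  exact key

/-- Apply the comultiplication to the last factor of `H ⊗ ⋯ ⊗ H`. -/
def comulLast (k : Type) [Field k] (H : Type) [Ring H] [HopfAlgebra k H] :
    (n : ℕ) → Tpow k H n →ₗ[k] Tpow k H (n + 1)
  | 0 => (Coalgebra.comul : H →ₗ[k] H ⊗[k] H)
  | n + 1 => (LinearMap.lTensor H (comulLast k H n) :)

theorem comulIter_succ_eq_comulLast (n : ℕ) (h : H) :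
    comulIter k H (n + 1) h = comulLast k H n (comulIter k H n h) := by
  induction n generalizing h with
  | zero => exact LinearMap.lTensor_id_apply (R := k) H H _
  | succ n ih =>
    have := LinearMap.ext (f := comulIter k H (n + 1))
      (g := comulLast k H n ∘ₗ comulIter k H n) ih
    change LinearMap.lTensor H (comulIter k H (n + 1)) (Coalgebra.comul h) =
      LinearMap.lTensor H (comulLast k H n)
        (LinearMap.lTensor H (comulIter k H n) (Coalgebra.comul h))
    rw [this, LinearMap.lTensor_comp, LinearMap.comp_apply]

theorem comulLast_tpow (n : ℕ) (x : Fin (n + 1) → H) :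
    comulLast k H n (tpow k H n x) = sweedler (Coalgebra.comul (R := k) (x (Fin.last n)))
      fun u v => tpow k H (n + 1) (Fin.snoc (Function.update x (Fin.last n) u) v) := by
  induction n with
  | zero => exact (sweedler_tmul_self _).symm
  | succ n ih =>
    have e := congrArg (fun t => (x 0 ⊗ₜ[k] t : H ⊗[k] Tpow k H (n + 1))) (ih fun i => x i.succ)
    refine e.trans ?_
    refine (map_sweedler (V := Tpow k H (n + 1)) (W := H ⊗[k] Tpow k H (n + 1))
      (isLinearMap_const_tmul isLinearMap_id' (x 0)) _ _).trans ?_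
    have : ∀ u v, (x 0 ⊗ₜ[k] tpow k H (n + 1)
          (Fin.snoc (Function.update (fun i : Fin (n + 1) => x i.succ) (Fin.last n) u) v) :
          H ⊗[k] Tpow k H (n + 1)) =
        tpow k H (n + 2) (Fin.snoc (Function.update x (Fin.last (n + 1)) u) v) := fun u v => by
      have : (Fin.snoc (Function.update x (Fin.last (n + 1)) u) v : Fin (n + 3) → H) =
          Fin.cons (x 0) (Fin.snoc (Function.update (fun i : Fin (n + 1) => x i.succ)
            (Fin.last n) u) v) := by
        rw [Fin.cons_snoc_eq_snoc_cons, Fin.cons_update, Fin.succ_last]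
        congr
        exact (Fin.cons_self_tail x).symm
      rw [this]
      rfl
    exact congrArg _ (funext₂ this)

/-- Decompose the last leg of a Sweedler representation. -/
def IterRepr.refine {n : ℕ} {h : H} (R : IterRepr k H n h) : IterRepr k H (n + 1) h where
  ι := Σ _ : R.ι, H × H
  s := R.s.sigma fun i => (TensorProduct.exists_finset
    (Coalgebra.comul (R := k) (R.leg i (Fin.last n)))).choose
  leg p := Fin.snoc (Function.update (R.leg p.1) (Fin.last n) p.2.1) p.2.2
  eq := by
    rw [comulIter_succ_eq_comulLast, ← R.eq, map_sum, Finset.sum_sigma]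
    exact Finset.sum_congr rfl fun i _ => (comulLast_tpow n (R.leg i)).symm

/-- The Sweedler representation of `Δ` underlying `sweedler`. -/
def IterRepr.ofComul (k : Type) [Field k] {H : Type} [Ring H] [HopfAlgebra k H] (h : H) :
    IterRepr k H 1 h where
  ι := H × H
  s := (TensorProduct.exists_finset (Coalgebra.comul (R := k) h)).choose
  leg p := ![p.1, p.2]
  eq := (sweedler_tmul_self (Coalgebra.comul (R := k) h)).trans
    (LinearMap.lTensor_id_apply (R := k) H H _).symm

end IterRepr

section Spec

variable {k : Type} [Field k] {H : Type} [Ring H] [HopfAlgebra k H] {A : Type} [Ring A]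
  [Algebra k A] {rho : H →ₗ[k] A →ₗ[k] A} {sg : H →ₗ[k] H →ₗ[k] k}

theorem IsModuleAlgebraAction.isSweedlerAction (h : IsModuleAlgebraAction k H A rho) :
    IsSweedlerAction rho where
  apply_mul x a b := h.1.1 x a b (IterRepr.ofComul k x)
  one_apply := h.1.2.2
  mul_apply := h.2

theorem IsCrossedMul.isSweedlerCrossedMul (hco : Cocomm k H)
    {mul : (A ⊗[k] H) →ₗ[k] (A ⊗[k] H) →ₗ[k] (A ⊗[k] H)} (hmul : IsCrossedMul k H A rho sg mul) :
    IsSweedlerCrossedMul rho sg (TensorProduct.lift mul) := by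
  intro a g b h
  rw [TensorProduct.lift.tmul, hmul a b g h (IterRepr.ofComul k g).refine (IterRepr.ofComul k h)]
  have e : ∀ x y z, ∑ j ∈ (IterRepr.ofComul k h).s,
      (sg y ((IterRepr.ofComul k h).leg j 0) • (a * rho x b)) ⊗ₜ[k]
        (z * (IterRepr.ofComul k h).leg j 1) =
      sweedler (Coalgebra.comul (R := k) h) fun h₁ h₂ => (sg y h₁ • (a * rho x b)) ⊗ₜ (z * h₂) :=
    fun x y z => rfl
  simp only [e]
  rw [(IterRepr.ofComul k g).refine.sum_eq_sweedler_sweedler (fun x y z =>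
    sweedler (Coalgebra.comul (R := k) h) fun h₁ h₂ => (sg y h₁ • (a * rho x b)) ⊗ₜ[k] (z * h₂))
    (by fun_prop) (by fun_prop) (by fun_prop)]
  congr! 3 with x y
  rw [twistedMul_tmul, map_sweedler (isLinearMap_const_tmul isLinearMap_id' _),
    sweedler_cocomm hco y _ (by fun_prop) (by fun_prop)]
  congr! 3 with u v
  rw [map_sweedler (isLinearMap_const_tmul isLinearMap_id' _),
    sweedler_cocomm hco h _ (by fun_prop) (by fun_prop)]
  simp only [TensorProduct.smul_tmul]

theorem IsHorFace.comp_isVerFace {n : ℕ} {i : Fin (n + 1)}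
    {Dver : ((Tpow k H (n + 1) : Type) ⊗[k] (Tpow k A (n + 1) : Type)) →ₗ[k]
      ((Tpow k H (n + 1) : Type) ⊗[k] (Tpow k A n : Type))}
    {Dhor : ((Tpow k H (n + 1) : Type) ⊗[k] (Tpow k A n : Type)) →ₗ[k]
      ((Tpow k H n : Type) ⊗[k] (Tpow k A n : Type))}
    (hDhor : IsHorFace k H A sg n n i Dhor) (hDver : IsVerFace k H A (n + 1) n i Dver) :
    Dhor ∘ₗ Dver =
      TensorProduct.map (mergeMap (twistedMul sg) n i) (mergeMap (LinearMap.mul' k A) n i) := by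
  refine TensorProduct.ext (tpow_ext Submodule.span_univ fun g _ =>
    tpow_ext Submodule.span_univ fun a _ => ?_)
  simp only [LinearMap.compr₂ₛₗ_apply, LinearMap.comp_apply, TensorProduct.mk_apply,
    TensorProduct.map_tmul, mergeMap_tpow, LinearMap.mul'_apply]
  rw [hDver, hDhor _ _ (IterRepr.ofComul k _) (IterRepr.ofComul k _)]
  have hl := isLinearMap_tmul_const (tpow_mergeAt_isLinearMap (k := k) i g)
    (tpow k A n (mergeAt i a (a i.castSucc * a i.succ)))
  rw [twistedMul_tmul, map_sweedler hl]
  simp only [map_sweedler hl, hl.map_smul]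
  simp only [tpow_update_zero_smul, TensorProduct.tmul_smul]
  rfl

end Spec

section PiFinset

variable {M : Type*} [AddCommMonoid M]

theorem Fin.sum_piFinset_succ {n : ℕ} {α : Fin (n + 1) → Type*} (s : ∀ i, Finset (α i))
    (f : (∀ i, α i) → M) :
    ∑ e ∈ Fintype.piFinset s, f e =
      ∑ x ∈ s 0, ∑ e ∈ Fintype.piFinset (fun i : Fin n => s i.succ), f (Fin.cons x e) := by
  rw [← Finset.sum_product']
  refine Finset.sum_nbij' (fun e => (e 0, fun i => e i.succ)) (fun p => Fin.cons p.1 p.2) ?_ ?_ ?_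
    ?_ ?_
  · intro e he
    simp only [Fintype.mem_piFinset, Finset.mem_product] at he ⊢
    exact ⟨he 0, fun i => he i.succ⟩
  · intro p hp
    simp only [Fintype.mem_piFinset, Finset.mem_product] at hp ⊢
    exact Fin.cases hp.1 hp.2
  · exact fun e _ => Fin.cons_self_tail e
  · exact fun p _ => rfl
  · exact fun e _ => congrArg f (Fin.cons_self_tail e).symm

theorem Fintype.sum_piFinset_sigma {ι : Type*} [DecidableEq ι] [Fintype ι] {α : ι → Type*}
    {β : ∀ i, α i → Type*} (s : ∀ i, Finset (α i)) (t : ∀ i a, Finset (β i a))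
    (f : (∀ i, Σ a, β i a) → M) :
    ∑ e ∈ Fintype.piFinset (fun i => (s i).sigma (t i)), f e =
      ∑ e ∈ Fintype.piFinset s, ∑ d ∈ Fintype.piFinset (fun i => t i (e i)),
        f fun i => ⟨e i, d i⟩ := by
  rw [Finset.sum_sigma']
  refine Finset.sum_nbij' (fun e => ⟨fun i => (e i).1, fun i => (e i).2⟩)
    (fun p i => ⟨p.1 i, p.2 i⟩) ?_ ?_ ?_ ?_ ?_
  · intro e he
    simp only [Fintype.mem_piFinset, Finset.mem_sigma] at he ⊢
    exact ⟨fun i => (he i).1, fun i => (he i).2⟩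
  · intro p hp
    simp only [Fintype.mem_piFinset, Finset.mem_sigma] at hp ⊢
    exact fun i => ⟨hp.1 i, hp.2 i⟩
  · exact fun e _ => rfl
  · exact fun p _ => rfl
  · exact fun e _ => rfl

end PiFinset

section Phi

variable {k : Type} [Field k] {H : Type} [Ring H] [HopfAlgebra k H] {A : Type} [Ring A]
  [Algebra k A]

theorem tpowCoaction_tpow {n : ℕ} (w : Fin (n + 1) → H) :
    tpowCoaction k H n (tpow k H n w) =
      ∑ d ∈ Fintype.piFinset fun i => (IterRepr.ofComul k (w i)).s,
        (List.ofFn fun i => (d i).1).prod ⊗ₜ[k] tpow k H n fun i => (d i).2 := by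
  induction n with
  | zero =>
    rw [Fin.sum_piFinset_succ]
    simp only [Fintype.piFinset_of_isEmpty, Finset.univ_unique, Finset.sum_singleton, List.ofFn_succ,
      Fin.cons_zero, List.ofFn_zero, List.prod_singleton]
    exact (sweedler_tmul_self (Coalgebra.comul (R := k) (w 0))).symm
  | succ n ih =>
    rw [Fin.sum_piFinset_succ]
    refine (diagCoaction_tmul (N := Tpow k H n) _ (w 0) (tpow k H n fun i => w i.succ)).trans ?_
    refine Finset.sum_congr rfl fun p _ => ?_
    have key : ∀ F : H → Tpow k H n → H ⊗[k] (H ⊗[k] Tpow k H n),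
        (∀ y, IsLinearMap k fun x => F x y) → (∀ x, IsLinearMap k fun y => F x y) →
        sweedler (tpowCoaction k H n (tpow k H n fun i => w i.succ)) F =
          ∑ d ∈ Fintype.piFinset fun i : Fin (n + 1) => (IterRepr.ofComul k (w i.succ)).s,
            F (List.ofFn fun i => (d i).1).prod (tpow k H n fun i => (d i).2) :=
      fun F h₁ h₂ => by
        rw [ih, sweedler_sum _ _ _ h₁ h₂]
        simp only [sweedler_tmul _ _ _ h₁ h₂]
    refine (key _ (by fun_prop) (by fun_prop)).trans (Finset.sum_congr rfl fun d _ => ?_)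
    conv_rhs => rw [List.ofFn_succ, List.prod_cons]
    rfl

/-- The leg `j` of the Sweedler representation `R i`, or `0` if there is no such leg. -/
def IterRepr.legAt {n : ℕ} {g : Fin (n + 1) → H} (R : ∀ i : Fin (n + 1), IterRepr k H (i + 1) (g i))
    (e : ∀ i, (R i).ι) (i : Fin (n + 1)) (j : ℕ) : H :=
  if hj : j < i + 2 then (R i).leg (e i) ⟨j, hj⟩ else 0

/-- The summand `(b₀₁, b₁₂, … | S(b₀₀b₁₁⋯)(a₀), S(b₁₀b₂₁⋯)(a₁), …)` of the formula for `Φ`. -/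
def phiTerm (rho : H →ₗ[k] A →ₗ[k] A) {n : ℕ} (a : Fin (n + 1) → A) (b : Fin (n + 1) → ℕ → H) :
    Tpow k H n ⊗[k] Tpow k A n :=
  tpow k H n (fun i => b i (i + 1)) ⊗ₜ tpow k A n fun i =>
    rho (HopfAlgebra.antipode k
      (List.ofFn fun m : Fin (n + 1 - i) => b ⟨i + m, by omega⟩ m).prod) (a i)

theorem IsPhi.apply_eq_sum_phiTerm {rho : H →ₗ[k] A →ₗ[k] A} {n : ℕ}
    {Phi : (Tpow k (A ⊗[k] H) n : Type) →ₗ[k] ((Tpow k H n : Type) ⊗[k] (Tpow k A n : Type))}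
    (hPhi : IsPhi k H A rho n Phi) (a : Fin (n + 1) → A) (g : Fin (n + 1) → H)
    (R : ∀ i : Fin (n + 1), IterRepr k H ((i : ℕ) + 1) (g i)) :
    Phi (tpow k (A ⊗[k] H) n fun i => a i ⊗ₜ[k] g i) =
      ∑ e ∈ Fintype.piFinset fun i => (R i).s, phiTerm rho a (IterRepr.legAt R e) := by
  rw [hPhi a g R]
  refine Finset.sum_congr rfl fun e _ => ?_
  unfold phiTerm IterRepr.legAt
  congr! 8 with i i m
  · rw [dif_pos (by omega)]
    rfl
  · funext m
    rw [dif_pos (by simp only; omega)]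

theorem phiTerm_succ (rho : H →ₗ[k] A →ₗ[k] A) {n : ℕ} (a : Fin (n + 2) → A)
    (b : Fin (n + 2) → ℕ → H) :
    phiTerm rho a b = ((b 0 1 ⊗ₜ tpow k H n fun i => b i.succ (i + 2)) : H ⊗[k] Tpow k H n) ⊗ₜ
      ((rho (HopfAlgebra.antipode k (b 0 0 * (List.ofFn fun m : Fin (n + 1) =>
        b m.succ (m + 1)).prod)) (a 0) ⊗ₜ tpow k A n fun i => rho (HopfAlgebra.antipode k
          (List.ofFn fun m : Fin (n + 1 - i) => b (Fin.succ ⟨i + m, by omega⟩) m).prod)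
            (a i.succ)) : A ⊗[k] Tpow k A n) := by
  have h₀ : (List.ofFn fun m : Fin (n + 1 + 1 - ((0 : Fin (n + 2)) : ℕ)) =>
      b ⟨((0 : Fin (n + 2)) : ℕ) + m, by omega⟩ m) =
      b 0 0 :: List.ofFn fun m : Fin (n + 1) => b m.succ (m + 1) := by
    refine (List.ofFn_congr (n := n + 2) (by simp) _).trans (List.ofFn_succ.trans ?_)
    congr! 3 with m
    simp
    rfl
  have h₁ : ∀ i : Fin (n + 1), (List.ofFn fun m : Fin (n + 1 + 1 - (i.succ : ℕ)) =>
      b ⟨(i.succ : ℕ) + m, by omega⟩ m) =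
      List.ofFn fun m : Fin (n + 1 - i) => b (Fin.succ ⟨i + m, by omega⟩) m := fun i => by
    refine (List.ofFn_congr (n := n + 1 - i) (by simp) _).trans ?_
    congr! 3 with m
    ext
    simp
    omega
  simp only [← h₁]
  rw [← List.prod_cons, ← h₀]
  rfl

theorem sweedler_tpowCoaction {V : Type*} [AddCommMonoid V] [Module k V] {n : ℕ}
    (w : Fin (n + 1) → H) (F : H → Tpow k H n → V) (h₁ : ∀ y, IsLinearMap k fun x => F x y)
    (h₂ : ∀ x, IsLinearMap k fun y => F x y) :
    sweedler (tpowCoaction k H n (tpow k H n w)) F =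
      ∑ d ∈ Fintype.piFinset fun i => (IterRepr.ofComul k (w i)).s,
        F (List.ofFn fun i => (d i).1).prod (tpow k H n fun i => (d i).2) := by
  rw [tpowCoaction_tpow, sweedler_sum _ _ _ h₁ h₂]
  simp only [sweedler_tmul _ _ _ h₁ h₂]

namespace IterRepr

variable {n : ℕ} {g : Fin (n + 2) → H} (R₀ : IterRepr k H 1 (g 0))
  (R : ∀ i : Fin (n + 1), IterRepr k H (i + 1) (g i.succ))

/-- Prepend a Sweedler representation to a family and refine the members of the family. -/
def consRefine (i : Fin (n + 2)) : IterRepr k H (i + 1) (g i) :=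
  Fin.cases R₀ (fun j => (R j).refine) i

variable (x : R₀.ι) (e : ∀ i, (R i).ι) (d : Fin (n + 1) → H × H)

/-- An index of the family `consRefine R₀ R`. -/
def consIndex : ∀ i, (consRefine R₀ R i).ι :=
  Fin.cons (α := fun i => (consRefine R₀ R i).ι) x fun i => (⟨e i, d i⟩ : Σ _ : (R i).ι, H × H)

theorem legAt_consRefine_zero (j : Fin 2) :
    legAt (consRefine R₀ R) (consIndex R₀ R x e d) 0 j = R₀.leg x j :=
  dif_pos j.2

theorem legAt_consRefine_succ_of_le (i : Fin (n + 1)) {j : ℕ} (hj : j ≤ i) :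
    legAt (consRefine R₀ R) (consIndex R₀ R x e d) i.succ j = legAt R e i j := by
  unfold legAt
  rw [dif_pos (by simp; omega), dif_pos (by omega)]
  change (Fin.snoc (Function.update ((R i).leg (e i)) (Fin.last (i + 1)) (d i).1) (d i).2 :
    Fin (i + 3) → H) (Fin.castSucc ⟨j, by omega⟩) = _
  rw [Fin.snoc_castSucc, Function.update_of_ne]
  simp [Fin.ext_iff]
  omega

theorem legAt_consRefine_succ_left (i : Fin (n + 1)) :
    legAt (consRefine R₀ R) (consIndex R₀ R x e d) i.succ (i + 1) = (d i).1 := by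
  unfold legAt
  rw [dif_pos (by simp)]
  change (Fin.snoc (Function.update ((R i).leg (e i)) (Fin.last (i + 1)) (d i).1) (d i).2 :
    Fin (i + 3) → H) (Fin.castSucc (Fin.last (i + 1))) = _
  rw [Fin.snoc_castSucc, Function.update_self]

theorem legAt_consRefine_succ_right (i : Fin (n + 1)) :
    legAt (consRefine R₀ R) (consIndex R₀ R x e d) i.succ (i + 2) = (d i).2 := by
  unfold legAt
  rw [dif_pos (by simp)]
  change (Fin.snoc (Function.update ((R i).leg (e i)) (Fin.last (i + 1)) (d i).1) (d i).2 :
    Fin (i + 3) → H) (Fin.last (i + 2)) = _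
  rw [Fin.snoc_last]

theorem sum_piFinset_consRefine {M : Type*} [AddCommMonoid M]
    (f : (∀ i, (consRefine R₀ R i).ι) → M) :
    ∑ e ∈ Fintype.piFinset fun i => (consRefine R₀ R i).s, f e =
      ∑ e ∈ Fintype.piFinset fun i => (R i).s, ∑ x ∈ R₀.s,
        ∑ d ∈ Fintype.piFinset fun i => (ofComul k ((R i).leg (e i) (Fin.last (i + 1)))).s,
          f (consIndex R₀ R x e d) := by
  refine (Fin.sum_piFinset_succ _ _).trans (Eq.trans ?_ Finset.sum_comm)
  refine Finset.sum_congr rfl fun x _ => ?_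
  exact Fintype.sum_piFinset_sigma (fun i => (R i).s)
    (fun i y => (ofComul k ((R i).leg y (Fin.last (i + 1)))).s)
    fun e => f (Fin.cons (α := fun i => (consRefine R₀ R i).ι) x e)

theorem phiTerm_consRefine (rho : H →ₗ[k] A →ₗ[k] A) (a : Fin (n + 2) → A) :
    phiTerm rho a (legAt (consRefine R₀ R) (consIndex R₀ R x e d)) =
      ((R₀.leg x 1 ⊗ₜ tpow k H n fun i => (d i).2) : H ⊗[k] Tpow k H n) ⊗ₜ
      ((rho (HopfAlgebra.antipode k (R₀.leg x 0 * (List.ofFn fun i => (d i).1).prod)) (a 0) ⊗ₜ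
        tpow k A n fun i => rho (HopfAlgebra.antipode k (List.ofFn fun m : Fin (n + 1 - i) =>
          legAt R e ⟨i + m, by omega⟩ m).prod) (a i.succ)) : A ⊗[k] Tpow k A n) := by
  rw [phiTerm_succ]
  have h₀ : legAt (consRefine R₀ R) (consIndex R₀ R x e d) 0 0 = R₀.leg x 0 :=
    legAt_consRefine_zero R₀ R x e d 0
  have h₁ : legAt (consRefine R₀ R) (consIndex R₀ R x e d) 0 1 = R₀.leg x 1 :=
    legAt_consRefine_zero R₀ R x e d 1
  have h₂ : ∀ (i : Fin (n + 1)) (m : Fin (n + 1 - i)),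
      legAt (consRefine R₀ R) (consIndex R₀ R x e d) (Fin.succ ⟨i + m, by omega⟩) m =
        legAt R e ⟨i + m, by omega⟩ m := fun i m =>
    legAt_consRefine_succ_of_le R₀ R x e d _ (Nat.le_add_left _ _)
  simp only [h₀, h₁, h₂, legAt_consRefine_succ_left, legAt_consRefine_succ_right]
  rfl

end IterRepr

theorem exists_phiRec_eq_sum_phiTerm (rho : H →ₗ[k] A →ₗ[k] A) {n : ℕ} (a : Fin (n + 1) → A)
    (g : Fin (n + 1) → H) : ∃ R : ∀ i : Fin (n + 1), IterRepr k H (i + 1) (g i),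
      phiRec rho n (tpow k (A ⊗[k] H) n fun i => a i ⊗ₜ g i) =
        ∑ e ∈ Fintype.piFinset fun i => (R i).s, phiTerm rho a (IterRepr.legAt R e) := by
  induction n with
  | zero =>
    refine ⟨fun i => Fin.cases (IterRepr.ofComul k (g 0)) (fun j => j.elim0) i, ?_⟩
    rw [Fin.sum_piFinset_succ]
    refine Finset.sum_congr rfl fun x _ => ?_
    simp [phiTerm, IterRepr.legAt]
    rfl
  | succ n ih =>
    obtain ⟨R, hR⟩ := ih (fun i => a i.succ) fun i => g i.succ
    refine ⟨IterRepr.consRefine (IterRepr.ofComul k (g 0)) R, ?_⟩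
    rw [IterRepr.sum_piFinset_consRefine]
    change phiStep rho (tpowCoaction k H n) (Tpow k A n) ((a 0 ⊗ₜ[k] g 0) ⊗ₜ[k] phiRec rho n
      (tpow k (A ⊗[k] H) n fun i => a i.succ ⊗ₜ g i.succ)) = _
    rw [hR, TensorProduct.tmul_sum, map_sum]
    refine Finset.sum_congr rfl fun e _ => ?_
    have hw : ∀ i : Fin (n + 1), IterRepr.legAt R e i (i + 1) =
        (R i).leg (e i) (Fin.last (i + 1)) := fun i => dif_pos (by omega)
    have hT : phiTerm rho (fun i => a i.succ) (IterRepr.legAt R e) =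
        tpow k H n (fun i => (R i).leg (e i) (Fin.last (i + 1))) ⊗ₜ tpow k A n fun i =>
          rho (HopfAlgebra.antipode k (List.ofFn fun m : Fin (n + 1 - i) =>
            IterRepr.legAt R e ⟨i + m, by omega⟩ m).prod) (a i.succ) := by
      simp only [phiTerm, hw]
    rw [hT, phiStep_tmul]
    refine Finset.sum_congr rfl fun x _ => ?_
    refine (sweedler_tpowCoaction _ _ (by fun_prop) (by fun_prop)).trans ?_
    refine Finset.sum_congr rfl fun d _ => ?_
    exact (IterRepr.phiTerm_consRefine (g := g) (IterRepr.ofComul k (g 0)) R x e d rho a).symm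

theorem IsPhi.eq_phiRec {rho : H →ₗ[k] A →ₗ[k] A} {n : ℕ}
    {Phi : (Tpow k (A ⊗[k] H) n : Type) →ₗ[k] ((Tpow k H n : Type) ⊗[k] (Tpow k A n : Type))}
    (hPhi : IsPhi k H A rho n Phi) : Phi = phiRec rho n := by
  refine tpow_ext (TensorProduct.span_tmul_eq_top k A H) fun x hx => ?_
  choose a g hag using hx
  obtain ⟨R, hR⟩ := exists_phiRec_eq_sum_phiTerm rho a g
  obtain rfl : (fun i => a i ⊗ₜ g i) = x := funext hag
  rw [hPhi.apply_eq_sum_phiTerm a g R, hR]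

end Phi

theorem IsAlgFace.eq_mergeMap {k : Type} [Field k] {H : Type} [Ring H] [HopfAlgebra k H]
    {A : Type} [Ring A] [Algebra k A] {mul : (A ⊗[k] H) →ₗ[k] (A ⊗[k] H) →ₗ[k] (A ⊗[k] H)}
    {n : ℕ} {i : Fin (n + 1)}
    {F : (Tpow k (A ⊗[k] H) (n + 1) : Type) →ₗ[k] (Tpow k (A ⊗[k] H) n : Type)}
    (hF : IsAlgFace k H A mul n i F) : F = mergeMap (TensorProduct.lift mul) n i := by
  refine tpow_ext Submodule.span_univ fun x _ => ?_
  rw [hF, mergeMap_tpow, TensorProduct.lift.tmul]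

/-- Under the standing assumptions (here with `N = n + 1 ≥ 1` and
`0 ≤ i ≤ N − 1`), `Φ` intertwines the `i`-th face of the cyclic module of `A #_σ H` with the
diagonal face `dᵢ ∘ δᵢ`:  `(dᵢ ∘ δᵢ) ∘ Φ = Φ ∘ δᵢ^{A#_σH}`. -/
theorem phi_intertwines_face
    (k : Type) [Field k] (H : Type) [Ring H] [HopfAlgebra k H]
    (A : Type) [Ring A] [Algebra k A]
    (rho : H →ₗ[k] A →ₗ[k] A) (sg : H →ₗ[k] H →ₗ[k] k)
    (hco : Cocomm k H) (hma : IsModuleAlgebraAction k H A rho)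
    (hnorm : NormalKA k H A sg) (hcoc : CocycleKA k H A sg)
    (htw : TwistedModuleK k H A rho sg) (hinv : ConvInvertibleK k H A sg)
    (n : ℕ) (i : Fin (n + 1))
    (mul : (A ⊗[k] H) →ₗ[k] (A ⊗[k] H) →ₗ[k] (A ⊗[k] H))
    (hmul : IsCrossedMul k H A rho sg mul)
    (PhiBig : (Tpow k (A ⊗[k] H) (n + 1) : Type) →ₗ[k]
      ((Tpow k H (n + 1) : Type) ⊗[k] (Tpow k A (n + 1) : Type)))
    (PhiSmall : (Tpow k (A ⊗[k] H) n : Type) →ₗ[k]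
      ((Tpow k H n : Type) ⊗[k] (Tpow k A n : Type)))
    (Falg : (Tpow k (A ⊗[k] H) (n + 1) : Type) →ₗ[k] (Tpow k (A ⊗[k] H) n : Type))
    (Dver : ((Tpow k H (n + 1) : Type) ⊗[k] (Tpow k A (n + 1) : Type)) →ₗ[k]
      ((Tpow k H (n + 1) : Type) ⊗[k] (Tpow k A n : Type)))
    (Dhor : ((Tpow k H (n + 1) : Type) ⊗[k] (Tpow k A n : Type)) →ₗ[k]
      ((Tpow k H n : Type) ⊗[k] (Tpow k A n : Type)))
    (hPhiBig : IsPhi k H A rho (n + 1) PhiBig)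
    (hPhiSmall : IsPhi k H A rho n PhiSmall)
    (hFalg : IsAlgFace k H A mul n i Falg)
    (hDver : IsVerFace k H A (n + 1) n i Dver)
    (hDhor : IsHorFace k H A sg n n i Dhor) :
    (Dhor ∘ₗ Dver) ∘ₗ PhiBig = PhiSmall ∘ₗ Falg := by
  rw [hDhor.comp_isVerFace hDver, hPhiBig.eq_phiRec, hPhiSmall.eq_phiRec, hFalg.eq_mergeMap]
  exact (phiRec_comp_mergeMap (hmul.isSweedlerCrossedMul hco) hma.isSweedlerAction hco i).symm
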